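/- arXiv:1906.02666 — 5 statements merged into one kernel-verified Lean document; each statement's English description precedes it below -/
import Mathlib

section
/- For every n ≥ 1, every function g : {−1,1}^n → ℝ, every randomized algorithm A that determines g, and every integer k ≥ 1, one has Σ_{S ⊆ {1,…,n}, |S| = k} ĝ(S)² ≤ k · δ_A · E[g(σ)²], where δ_A is the revealment of A and σ is uniform on {−1,1}^n. -/
open scoped BigOperators

noncomputable section

/-- A deterministic decision tree querying coordinates of an input in `{-1,1}^n`
(encoded as `Fin n → Bool`): either it stops, or it queries a coordinate and branches on
its value. -/
inductive DTree (n : ℕ) : Type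
  | leaf : DTree n
  | node : Fin n → DTree n → DTree n → DTree n

/-- The set of coordinates queried by the tree `T` on input `x`. -/
def DTree.queries {n : ℕ} : DTree n → (Fin n → Bool) → Finset (Fin n)
  | .leaf, _ => ∅
  | .node i t₀ t₁, x => insert i (if x i then t₁.queries x else t₀.queries x)

/-- `g` is determined by the values of `x` on the set `s` of already revealed coordinates:
`g` is constant on the set of configurations agreeing with `x` on `s`. -/
def DeterminedOn {n : ℕ} (g : (Fin n → Bool) → ℝ) (s : Finset (Fin n))
    (x : Fin n → Bool) : Prop :=
  ∀ y : Fin n → Bool, (∀ i ∈ s, y i = x i) → g y = g x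

/-- On input `x`, the tree `T`, run with the set `s` of coordinates already revealed,
determines `g` and stops exactly as soon as the revealed values determine `g`. -/
def DTree.proper {n : ℕ} (g : (Fin n → Bool) → ℝ) :
    DTree n → Finset (Fin n) → (Fin n → Bool) → Prop
  | .leaf, s, x => DeterminedOn g s x
  | .node i t₀ t₁, s, x => ¬ DeterminedOn g s x ∧
      (if x i then t₁.proper g (insert i s) x else t₀.proper g (insert i s) x)

/-- The `{-1,1}`-valued character `χ_S`. -/
def chi {n : ℕ} (S : Finset (Fin n)) (x : Fin n → Bool) : ℝ :=
  ∏ i ∈ S, (if x i then (1 : ℝ) else -1)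

/-- The Fourier–Walsh coefficient `ĝ(S) = E[g(σ) χ_S(σ)]` for `σ` uniform on `{-1,1}^n`. -/
def walshCoeff {n : ℕ} (g : (Fin n → Bool) → ℝ) (S : Finset (Fin n)) : ℝ :=
  (∑ x : Fin n → Bool, g x * chi S x) / 2 ^ n

/-- The probability, over a uniform input `x` and over the randomness `z ∼ μ` of the
algorithm, that coordinate `i` is queried. -/
def revealProb {n : ℕ} {ι : Type*} (μ : PMF ι) (T : ι → DTree n) (i : Fin n) : ℝ :=
  ∑' z : ι, (μ z).toReal *
    (((Finset.univ.filter fun x : Fin n → Bool => i ∈ (T z).queries x).card : ℝ) / 2 ^ n)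

/-- `J` is the set of coordinates revealed by an adaptive exploration: it only depends on the
values of the revealed coordinates. -/
def IsExploration {n : ℕ} (J : (Fin n → Bool) → Finset (Fin n)) : Prop :=
  ∀ x y : Fin n → Bool, (∀ i ∈ J x, y i = x i) → J y = J x

theorem DTree.isExploration_queries {n : ℕ} (T : DTree n) : IsExploration T.queries := by
  intro x y h
  induction T with
  | leaf => rfl
  | node i t₀ t₁ ih₀ ih₁ =>
    simp only [DTree.queries] at h ⊢
    have hi : y i = x i := h i (Finset.mem_insert_self _ _)
    rw [hi]
    split_ifs at h ⊢ with hx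
    · rw [ih₁ fun j hj => h j (Finset.mem_insert_of_mem hj)]
    · rw [ih₀ fun j hj => h j (Finset.mem_insert_of_mem hj)]

theorem DTree.proper.determinedOn {n : ℕ} {g : (Fin n → Bool) → ℝ} {T : DTree n}
    {s : Finset (Fin n)} {x : Fin n → Bool} (h : T.proper g s x) :
    DeterminedOn g (s ∪ T.queries x) x := by
  induction T generalizing s with
  | leaf => simpa [DTree.queries, DTree.proper] using h
  | node i t₀ t₁ ih₀ ih₁ =>
    simp only [DTree.proper, DTree.queries] at h ⊢
    rw [Finset.union_insert, ← Finset.insert_union]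
    obtain ⟨-, h⟩ := h
    split_ifs at h ⊢ with hx
    · exact ih₁ h
    · exact ih₀ h

theorem chi_mul_chi {n : ℕ} (S U : Finset (Fin n)) (x : Fin n → Bool) :
    chi S x * chi U x = chi (symmDiff S U) x := by
  have h : ∀ A : Finset (Fin n),
      chi A x = ∏ i, if i ∈ A then (if x i then (1 : ℝ) else -1) else 1 := fun A => by
    simp [chi, Finset.prod_ite_mem]
  rw [h, h, h, ← Finset.prod_mul_distrib]
  refine Finset.prod_congr rfl fun i _ => ?_
  by_cases hS : i ∈ S <;> by_cases hU : i ∈ U <;> cases x i <;>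
    simp [hS, hU, Finset.mem_symmDiff]

theorem chi_mul_self {n : ℕ} (S : Finset (Fin n)) (x : Fin n → Bool) :
    chi S x * chi S x = 1 := by
  rw [chi_mul_chi, symmDiff_self]
  exact Finset.prod_empty

theorem chi_update_not {n : ℕ} {U : Finset (Fin n)} {i : Fin n} (hi : i ∈ U)
    (x : Fin n → Bool) : chi U (Function.update x i (!x i)) = -chi U x := by
  simp only [chi]
  rw [← Finset.mul_prod_erase _ _ hi, ← Finset.mul_prod_erase _ _ hi, ← neg_mul]
  congr 1
  · cases x i <;> simp
  · refine Finset.prod_congr rfl fun j hj => ?_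
    rw [Function.update_of_ne (Finset.ne_of_mem_erase hj)]

/-- A function `F` of the revealed values is orthogonal to `χ_U` if it vanishes whenever all of
`U` is revealed. -/
theorem IsExploration.sum_mul_chi_eq_zero {n : ℕ} {J : (Fin n → Bool) → Finset (Fin n)}
    (hJ : IsExploration J) {F : (Fin n → Bool) → ℝ} (hF : ∀ x, DeterminedOn F (J x) x)
    {U : Finset (Fin n)} (hU : ∀ x, U ⊆ J x → F x = 0) :
    ∑ x, F x * chi U x = 0 := by
  have hne : ∀ x, F x * chi U x ≠ 0 → (U \ J x).Nonempty := fun x hx =>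
    Finset.sdiff_nonempty.2 fun h => hx (by rw [hU x h, zero_mul])
  let flip : (Fin n → Bool) → Fin n → Fin n → Bool := fun x i => Function.update x i (!x i)
  have hagree : ∀ x, ∀ i ∈ U \ J x, ∀ j ∈ J x, flip x i j = x j := fun x i hi j hj =>
    Function.update_of_ne (fun h : j = i => (Finset.mem_sdiff.1 hi).2 (h ▸ hj)) _ _
  let σ : (Fin n → Bool) → Fin n → Bool := fun x =>
    if h : (U \ J x).Nonempty then flip x ((U \ J x).min' h) else x
  have hσ : ∀ x (h : (U \ J x).Nonempty), σ x = flip x ((U \ J x).min' h) := fun x h =>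
    dif_pos h
  have hσJ : ∀ x (h : (U \ J x).Nonempty), J (σ x) = J x := fun x h => by
    rw [hσ x h]
    exact hJ _ _ (hagree x _ (Finset.min'_mem _ h))
  refine Finset.sum_ninvolution σ (fun x => ?_) (fun x hx => ?_) (fun x => Finset.mem_univ _)
    (fun x => ?_)
  · by_cases h : (U \ J x).Nonempty
    · have hm := Finset.min'_mem _ h
      rw [hσ x h, hF x _ (hagree x _ hm), chi_update_not (Finset.mem_sdiff.1 hm).1]
      ring
    · have h0 : F x = 0 := hU x (Finset.sdiff_eq_empty_iff_subset.1
        (Finset.not_nonempty_iff_eq_empty.1 h))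
      simp only [σ, dif_neg h, h0, zero_mul, add_zero]
  · have h := hne x hx
    rw [hσ x h]
    intro heq
    have := congrFun heq ((U \ J x).min' h)
    simp [flip] at this
  · by_cases h : (U \ J x).Nonempty
    · have h' : (U \ J (σ x)).Nonempty := by rwa [hσJ x h]
      have hm : (U \ J (σ x)).min' h' = (U \ J x).min' h := by simp only [hσJ x h]
      rw [hσ _ h', hm, hσ x h]
      simp [flip]
    · simp only [σ, dif_neg h]

/-- A function of the set of revealed coordinates is determined by the revealed values. -/
theorem IsExploration.determinedOn_comp {n : ℕ} {J : (Fin n → Bool) → Finset (Fin n)}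
    (hJ : IsExploration J) (f : Finset (Fin n) → ℝ) (x : Fin n → Bool) :
    DeterminedOn (fun y => f (J y)) (J x) x := fun y hy => by
  simp only [hJ x y hy]

theorem sum_chi_eq_zero {n : ℕ} {U : Finset (Fin n)} (hU : U.Nonempty) :
    ∑ x, chi U x = 0 := by
  have := IsExploration.sum_mul_chi_eq_zero (n := n) (J := fun _ => ∅) (fun _ _ _ => rfl)
    (F := fun _ => 1) (fun _ _ _ => rfl) (U := U)
    (fun _ h => absurd (Finset.subset_empty.1 h) hU.ne_empty)
  simpa using this

/-- The indicator that some coordinate of `S` belongs to `s`. -/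
def hits {n : ℕ} (S s : Finset (Fin n)) : ℝ := if Disjoint S s then 0 else 1

theorem hits_sq {n : ℕ} (S s : Finset (Fin n)) : hits S s * hits S s = hits S s := by
  unfold hits
  split_ifs <;> simp

theorem hits_le_sum {n : ℕ} (S s : Finset (Fin n)) :
    hits S s ≤ ∑ i ∈ S, if i ∈ s then (1 : ℝ) else 0 := by
  unfold hits
  split_ifs with h
  · exact Finset.sum_nonneg fun i _ => by split_ifs <;> simp
  · obtain ⟨i, hiS, his⟩ := Finset.not_disjoint_iff.1 h
    refine le_trans (by simp [his]) (Finset.single_le_sum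
      (f := fun i => if i ∈ s then (1 : ℝ) else 0)
      (fun i _ => by split_ifs <;> simp) hiS)

/-- For a function of the revealed values, only the part of `χ_S` on the event that `S` is
hit contributes to the Walsh coefficient. -/
theorem IsExploration.sum_mul_chi_mul_hits {n : ℕ} {J : (Fin n → Bool) → Finset (Fin n)}
    (hJ : IsExploration J) {g : (Fin n → Bool) → ℝ} (hg : ∀ x, DeterminedOn g (J x) x)
    {S : Finset (Fin n)} (hS : S.Nonempty) :
    ∑ x, g x * (chi S x * hits S (J x)) = 2 ^ n * walshCoeff g S := by
  have h := hJ.sum_mul_chi_eq_zero (F := fun x => g x * (1 - hits S (J x))) (U := S)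
    (fun x y hy => by simp only [hg x y hy, hJ x y hy]) (fun x hx => by
      have : ¬ Disjoint S (J x) := fun hd =>
        hS.ne_empty (Finset.disjoint_self_iff_empty S |>.1 (hd.mono_right hx))
      simp [hits, this])
  have hw : 2 ^ n * walshCoeff g S = ∑ x, g x * chi S x := by
    unfold walshCoeff
    field_simp
  rw [hw, ← sub_eq_zero, ← neg_eq_zero, ← h, ← Finset.sum_sub_distrib, ← Finset.sum_neg_distrib]
  exact Finset.sum_congr rfl fun x _ => by ring

theorem IsExploration.sum_chi_hits_mul_chi_hits {n : ℕ} {J : (Fin n → Bool) → Finset (Fin n)}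
    (hJ : IsExploration J) {S S' : Finset (Fin n)} (hcard : S.card = S'.card) (hne : S ≠ S') :
    ∑ x, (chi S x * hits S (J x)) * (chi S' x * hits S' (J x)) = 0 := by
  have key : ∀ s, symmDiff S S' ⊆ s → hits S s = 1 ∧ hits S' s = 1 := by
    intro s hs
    have aux : ∀ A B : Finset (Fin n), A.card = B.card → A ≠ B → symmDiff A B ⊆ s →
        hits A s = 1 := by
      intro A B hc hAB hsub
      obtain ⟨i, hiA, hiB⟩ := Finset.not_subset.1 fun h =>
        hAB (Finset.eq_of_subset_of_card_le h hc.ge)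
      exact if_neg (Finset.not_disjoint_iff.2
        ⟨i, hiA, hsub (Finset.mem_symmDiff.2 (Or.inl ⟨hiA, hiB⟩))⟩)
    exact ⟨aux S S' hcard hne hs, aux S' S hcard.symm hne.symm (symmDiff_comm S S' ▸ hs)⟩
  have h := hJ.sum_mul_chi_eq_zero (F := fun x => 1 - hits S (J x) * hits S' (J x))
    (U := symmDiff S S') (hJ.determinedOn_comp fun s => 1 - hits S s * hits S' s)
    (fun x hx => by simp [key _ hx])
  have h0 := sum_chi_eq_zero (U := symmDiff S S')
    (Finset.nonempty_iff_ne_empty.2 fun h => hne (symmDiff_eq_bot.1 h))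
  rw [← sub_eq_zero.2 (h0.trans h.symm), ← Finset.sum_sub_distrib]
  exact Finset.sum_congr rfl fun x _ => by rw [← chi_mul_chi]; ring

/-- The weight of `g` at level `k` is controlled by the probabilities that the exploration hits
the sets of size `k`. -/
theorem IsExploration.sq_sum_walshCoeff_sq_le {n : ℕ} {J : (Fin n → Bool) → Finset (Fin n)}
    (hJ : IsExploration J) {g : (Fin n → Bool) → ℝ} (hg : ∀ x, DeterminedOn g (J x) x)
    {k : ℕ} (hk : 1 ≤ k) {L : Finset (Finset (Fin n))} (hL : ∀ S ∈ L, S.card = k) :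
    (2 ^ n * ∑ S ∈ L, walshCoeff g S ^ 2) ^ 2 ≤
      (∑ x, g x ^ 2) * ∑ S ∈ L, walshCoeff g S ^ 2 * ∑ x, hits S (J x) := by
  let u : (Fin n → Bool) → ℝ := fun x => ∑ S ∈ L, walshCoeff g S * (chi S x * hits S (J x))
  have hgu : ∑ x, g x * u x = 2 ^ n * ∑ S ∈ L, walshCoeff g S ^ 2 := by
    simp only [u, Finset.mul_sum]
    rw [Finset.sum_comm]
    refine Finset.sum_congr rfl fun S hS => ?_
    have hSn : S.Nonempty := Finset.card_pos.1 (by rw [hL S hS]; omega)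
    calc _ = walshCoeff g S * ∑ x, g x * (chi S x * hits S (J x)) := by
          rw [Finset.mul_sum]
          exact Finset.sum_congr rfl fun x _ => by ring
      _ = _ := by rw [hJ.sum_mul_chi_mul_hits hg hSn]; ring
  have huu : ∑ x, u x ^ 2 = ∑ S ∈ L, walshCoeff g S ^ 2 * ∑ x, hits S (J x) := by
    simp only [u, sq (∑ S ∈ L, _ * (_ * _)), Finset.sum_mul_sum]
    rw [Finset.sum_comm]
    refine Finset.sum_congr rfl fun S hS => ?_
    rw [Finset.sum_comm, Finset.sum_eq_single_of_mem S hS]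
    · rw [Finset.mul_sum]
      refine Finset.sum_congr rfl fun x _ => ?_
      linear_combination (walshCoeff g S ^ 2 * hits S (J x) * hits S (J x)) * chi_mul_self S x +
        walshCoeff g S ^ 2 * hits_sq S (J x)
    · intro S' hS' hne
      calc _ = (walshCoeff g S * walshCoeff g S') *
            ∑ x, (chi S x * hits S (J x)) * (chi S' x * hits S' (J x)) := by
            rw [Finset.mul_sum]
            exact Finset.sum_congr rfl fun x _ => by ring
        _ = 0 := by
            rw [hJ.sum_chi_hits_mul_chi_hits ((hL S hS).trans (hL S' hS').symm) hne.symm,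
              mul_zero]
  rw [← hgu, ← huu]
  exact Finset.sum_mul_sq_le_sq_mul_sq _ _ _

/-- The probability, over a uniform input, that the tree `T` queries the coordinate `i`. -/
def DTree.queryProb {n : ℕ} (T : DTree n) (i : Fin n) : ℝ :=
  ((Finset.univ.filter fun x : Fin n → Bool => i ∈ T.queries x).card : ℝ) / 2 ^ n

theorem DTree.queryProb_nonneg {n : ℕ} (T : DTree n) (i : Fin n) : 0 ≤ T.queryProb i := by
  unfold DTree.queryProb
  positivity

theorem DTree.queryProb_le_one {n : ℕ} (T : DTree n) (i : Fin n) : T.queryProb i ≤ 1 := by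
  refine div_le_one_of_le₀ ?_ (by positivity)
  refine (Nat.cast_le.2 (Finset.card_filter_le _ _)).trans ?_
  simp

theorem PMF.hasSum_toReal {ι : Type*} (μ : PMF ι) : HasSum (fun z => (μ z).toReal) 1 := by
  have h := ENNReal.hasSum_toReal μ.tsum_coe_ne_top
  rwa [← ENNReal.tsum_toReal_eq μ.apply_ne_top, μ.tsum_coe, ENNReal.toReal_one] at h

theorem hasSum_revealProb {n : ℕ} {ι : Type*} (μ : PMF ι) (T : ι → DTree n) (i : Fin n) :
    HasSum (fun z => (μ z).toReal * (T z).queryProb i) (revealProb μ T i) := by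
  refine Summable.hasSum (Summable.of_nonneg_of_le (fun z => ?_) (fun z => ?_)
    μ.hasSum_toReal.summable)
  · exact mul_nonneg ENNReal.toReal_nonneg ((T z).queryProb_nonneg i)
  · exact mul_le_of_le_one_right ENNReal.toReal_nonneg ((T z).queryProb_le_one i)

theorem revealProb_nonneg {n : ℕ} {ι : Type*} (μ : PMF ι) (T : ι → DTree n) (i : Fin n) :
    0 ≤ revealProb μ T i :=
  (hasSum_revealProb μ T i).nonneg fun z =>
    mul_nonneg ENNReal.toReal_nonneg ((T z).queryProb_nonneg i)

theorem DTree.sq_sum_walshCoeff_sq_le {n : ℕ} {g : (Fin n → Bool) → ℝ} {T : DTree n}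
    (hT : ∀ x, T.proper g ∅ x) {k : ℕ} (hk : 1 ≤ k) {L : Finset (Finset (Fin n))}
    (hL : ∀ S ∈ L, S.card = k) :
    (∑ S ∈ L, walshCoeff g S ^ 2) ^ 2 ≤
      (∑ x, g x ^ 2) / 2 ^ n * ∑ S ∈ L, walshCoeff g S ^ 2 * ∑ i ∈ S, T.queryProb i := by
  have h := T.isExploration_queries.sq_sum_walshCoeff_sq_le
    (fun x => by simpa using (hT x).determinedOn) hk hL
  have hhits : ∀ S : Finset (Fin n), ∑ x, hits S (T.queries x) ≤
      2 ^ n * ∑ i ∈ S, T.queryProb i := by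
    intro S
    refine (Finset.sum_le_sum fun x _ => hits_le_sum S (T.queries x)).trans (le_of_eq ?_)
    rw [Finset.sum_comm, Finset.mul_sum]
    refine Finset.sum_congr rfl fun i _ => ?_
    rw [Finset.sum_boole, DTree.queryProb]
    field_simp
  have h2 : (2 ^ n * ∑ S ∈ L, walshCoeff g S ^ 2) ^ 2 ≤
      (∑ x, g x ^ 2) * ∑ S ∈ L, walshCoeff g S ^ 2 * (2 ^ n * ∑ i ∈ S, T.queryProb i) :=
    h.trans (mul_le_mul_of_nonneg_left
      (Finset.sum_le_sum fun S _ => mul_le_mul_of_nonneg_left (hhits S) (sq_nonneg _))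
      (Finset.sum_nonneg fun x _ => sq_nonneg _))
  have h3 : ∑ S ∈ L, walshCoeff g S ^ 2 * (2 ^ n * ∑ i ∈ S, T.queryProb i) =
      2 ^ n * ∑ S ∈ L, walshCoeff g S ^ 2 * ∑ i ∈ S, T.queryProb i := by
    rw [Finset.mul_sum]
    exact Finset.sum_congr rfl fun S _ => by ring
  rw [h3] at h2
  have hpos : (0 : ℝ) < 2 ^ n := by positivity
  rw [div_mul_eq_mul_div, le_div_iff₀ hpos]
  refine le_of_mul_le_mul_left ?_ hpos
  calc _ = (2 ^ n * ∑ S ∈ L, walshCoeff g S ^ 2) ^ 2 := by ring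
    _ ≤ _ := h2
    _ = _ := by ring

/-- **The Schramm–Steif randomized algorithm theorem.** For every `g : {-1,1}^n → ℝ`, every
randomized algorithm (a random decision tree `T z`, `z ∼ μ`) that determines `g` (stopping
as soon as `g` is determined), and every `k ≥ 1`,
`∑_{|S| = k} ĝ(S)² ≤ k · δ_A · E[g(σ)²]`, where `δ_A = max_i P(i is queried)` is the
revealment of the algorithm. -/
theorem schramm_steif {n : ℕ} (hn : 1 ≤ n) (g : (Fin n → Bool) → ℝ)
    {ι : Type*} (μ : PMF ι) (T : ι → DTree n)
    (hproper : ∀ z : ι, ∀ x : Fin n → Bool, (T z).proper g ∅ x)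
    (k : ℕ) (hk : 1 ≤ k) :
    ∑ S ∈ Finset.univ.filter (fun S : Finset (Fin n) => S.card = k),
        walshCoeff g S ^ 2
      ≤ (k : ℝ) * (⨆ i : Fin n, revealProb μ T i) *
        ((∑ x : Fin n → Bool, g x ^ 2) / 2 ^ n) := by
  set L := Finset.univ.filter fun S : Finset (Fin n) => S.card = k
  have hL : ∀ S ∈ L, S.card = k := fun S hS => (Finset.mem_filter.1 hS).2
  set W := ∑ S ∈ L, walshCoeff g S ^ 2 with hW
  set G := (∑ x : Fin n → Bool, g x ^ 2) / 2 ^ n with hG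
  set δ := ⨆ i : Fin n, revealProb μ T i
  have hW0 : 0 ≤ W := Finset.sum_nonneg fun S _ => sq_nonneg _
  have hG0 : 0 ≤ G := div_nonneg (Finset.sum_nonneg fun x _ => sq_nonneg _) (by positivity)
  have hδ0 : 0 ≤ δ := Real.iSup_nonneg (revealProb_nonneg μ T)
  have hδ : ∀ i, revealProb μ T i ≤ δ := le_ciSup (Set.finite_range _).bddAbove
  have hleft : HasSum (fun z => (μ z).toReal * W ^ 2) (W ^ 2) := by
    simpa using μ.hasSum_toReal.mul_right (W ^ 2)
  have hright : HasSum
      (fun z => G * ∑ S ∈ L, walshCoeff g S ^ 2 * ∑ i ∈ S, (μ z).toReal * (T z).queryProb i)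
      (G * ∑ S ∈ L, walshCoeff g S ^ 2 * ∑ i ∈ S, revealProb μ T i) :=
    (hasSum_sum fun S _ => (hasSum_sum fun i _ => hasSum_revealProb μ T i).mul_left _).mul_left _
  have hmean : W ^ 2 ≤ G * ∑ S ∈ L, walshCoeff g S ^ 2 * ∑ i ∈ S, revealProb μ T i := by
    refine hasSum_le (fun z => ?_) hleft hright
    refine (mul_le_mul_of_nonneg_left (DTree.sq_sum_walshCoeff_sq_le (hproper z) hk hL)
      ENNReal.toReal_nonneg).trans (le_of_eq ?_)
    simp only [← Finset.mul_sum, mul_left_comm _ (μ z).toReal]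
    rw [hG]
  have hsum : ∑ S ∈ L, walshCoeff g S ^ 2 * ∑ i ∈ S, revealProb μ T i ≤ W * (k * δ) := by
    rw [hW, Finset.sum_mul]
    refine Finset.sum_le_sum fun S hS => mul_le_mul_of_nonneg_left ?_ (sq_nonneg _)
    simpa [hL S hS] using Finset.sum_le_card_nsmul S _ δ fun i _ => hδ i
  rcases hW0.eq_or_lt with h | h
  · rw [← h]
    positivity
  · refine le_of_mul_le_mul_left ?_ h
    nlinarith [hmean.trans (mul_le_mul_of_nonneg_left hsum hG0)]

end
end

section
/- Let q : ℝ² → ℝ satisfy Condition (Weak) and let f be a dynamical q-field. Let (A_n) be Borel subsets of the space of continuous functions ℝ² → ℝ, and let (t_n), (s_n) be positive reals such that Cov(1_{f(0,·) ∈ A_n}, 1_{f(t_n,·) ∈ A_n}) → 0 as n → ∞, the probabilities P[f(0,·) ∈ A_n] are bounded away from 0 and 1, and t_n/s_n → 0. Then for every integer k ≥ 1, the probability P[ there exist times 0 ≤ u₁ < v₁ < u₂ < v₂ < ⋯ < u_k < v_k ≤ s_n with f(u_i,·) ∉ A_n and f(v_i,·) ∈ A_n for all 1 ≤ i ≤ k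 ] tends to 1 as n → ∞. -/
open MeasureTheory Set
open scoped ENNReal NNReal

noncomputable section

/-- The plane `ℝ²` with its Euclidean structure. -/
abbrev Plane := EuclideanSpace ℝ (Fin 2)

/-- Condition (Weak): `q` is `C²` with all derivatives up to order 2 bounded by
`c (1 ∨ |x|)^{-(1+δ)}`. -/
def CondWeak (q : Plane → ℝ) : Prop :=
  ContDiff ℝ 2 q ∧ ∃ c > (0 : ℝ), ∃ δ > (0 : ℝ), ∀ k : ℕ, k ≤ 2 → ∀ x : Plane,
    ‖iteratedFDeriv ℝ k q x‖ ≤ c * max 1 ‖x‖ ^ (-(1 + δ))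

/-- Covariance of the indicator functions of two events. -/
def covIndicator {Ω : Type*} [MeasurableSpace Ω] (P : Measure Ω) (A B : Set Ω) : ℝ :=
  (P (A ∩ B)).toReal - (P A).toReal * (P B).toReal

/-- A dynamical `q`-field: a jointly measurable, almost surely continuous map which is a
centered Gaussian family with covariance
`E[f(t,x) f(s,y)] = e^{-|t-s|} ∫ q(x-z) q(y-z) dz`. -/
structure IsDynQField {Ω : Type*} [MeasurableSpace Ω] (P : Measure Ω)
    (q : Plane → ℝ) (f : Ω → ℝ → Plane → ℝ) : Prop where
  measurable : Measurable fun p : Ω × (ℝ × Plane) => f p.1 p.2.1 p.2.2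
  continuous : ∀ᵐ ω ∂P,
    ContinuousOn (fun p : ℝ × Plane => f ω p.1 p.2) (Set.Ici 0 ×ˢ Set.univ)
  gaussian : ∀ (n : ℕ) (c : Fin n → ℝ) (ts : Fin n → ℝ) (xs : Fin n → Plane),
    (∀ i, 0 ≤ ts i) → ∃ v : ℝ≥0,
      P.map (fun ω => ∑ i, c i * f ω (ts i) (xs i)) = ProbabilityTheory.gaussianReal 0 v
  covariance : ∀ (s t : ℝ), 0 ≤ s → 0 ≤ t → ∀ x y : Plane,
    ∫ ω, f ω t x * f ω s y ∂P
      = Real.exp (-|t - s|) * ∫ z : Plane, q (x - z) * q (y - z)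

/-- The σ-algebra generated by the time-zero field `f(0,·)`. -/
def sigmaTimeZero {Ω : Type*} (f : Ω → ℝ → Plane → ℝ) : MeasurableSpace Ω :=
  ⨆ x : Plane, MeasurableSpace.comap (fun ω => f ω 0 x) inferInstance

open ProbabilityTheory

/-- Laws of processes are determined by the characteristic functions of finite linear
combinations of their coordinates. -/
lemma map_eq_of_charFun_linear_combinations {ι α β : Type*} [MeasurableSpace α]
    [MeasurableSpace β] (μ : Measure α) (ν : Measure β) [IsProbabilityMeasure μ]
    [IsProbabilityMeasure ν] {X : α → ι → ℝ} {Y : β → ι → ℝ} (hX : Measurable X)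
    (hY : Measurable Y)
    (h : ∀ (n : ℕ) (c : Fin n → ℝ) (x : Fin n → ι),
      ∫ a, Complex.exp ((∑ k, c k * X a (x k) : ℝ) * Complex.I) ∂μ
        = ∫ b, Complex.exp ((∑ k, c k * Y b (x k) : ℝ) * Complex.I) ∂ν) :
    μ.map X = ν.map Y := by
  have := Measure.isProbabilityMeasure_map (μ := μ) hX.aemeasurable
  have := Measure.isProbabilityMeasure_map (μ := ν) hY.aemeasurable
  refine IsProjectiveLimit.unique (P := fun I : Finset ι => (ν.map Y).map I.restrict)
    (fun I => ?_) (fun I => rfl)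
  classical
  refine Measure.ext_of_charFunDual (funext fun L => ?_)
  have key : ∀ w : ι → ℝ, L (I.restrict w)
      = ∑ k, L (Pi.single (I.equivFin.symm k) 1) * w (I.equivFin.symm k) := by
    intro w
    rw [Equiv.sum_comp I.equivFin.symm (fun i => L (Pi.single i 1) * w i)]
    conv_lhs => rw [← Finset.univ_sum_single (I.restrict w), map_sum]
    refine Finset.sum_congr rfl fun i _ => ?_
    have : (Pi.single i (I.restrict w i) : I → ℝ) = w i • Pi.single i (1 : ℝ) := by
      rw [← Pi.single_smul]; simp
    rw [this, map_smul, smul_eq_mul, mul_comm]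
  have hr : Measurable (I.restrict (π := fun _ : ι => ℝ)) := Finset.measurable_restrict I
  have hL : Measurable fun v : I → ℝ => Complex.exp (L v * Complex.I) := by fun_prop
  have hLX : Measurable fun w : ι → ℝ => Complex.exp (L (I.restrict w) * Complex.I) :=
    hL.comp hr
  simp only [charFunDual_apply]
  rw [integral_map hr.aemeasurable hL.aestronglyMeasurable,
    integral_map hr.aemeasurable hL.aestronglyMeasurable,
    integral_map hX.aemeasurable hLX.aestronglyMeasurable,
    integral_map hY.aemeasurable hLX.aestronglyMeasurable]
  simp only [key]
  exact h _ _ _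

/-- The law `μ` on `T → ℝ` is centered Gaussian with covariance kernel `K`, expressed through
characteristic functions. -/
def IsCenteredGaussianLaw {T : Type*} (K : T → T → ℝ) (μ : Measure (T → ℝ)) : Prop :=
  ∀ (n : ℕ) (c : Fin n → ℝ) (x : Fin n → T),
    ∫ z, Complex.exp ((∑ k, c k * z (x k) : ℝ) * Complex.I) ∂μ
      = Complex.exp ((-(∑ i, ∑ j, c i * c j * K (x i) (x j)) / 2 : ℝ))

section OrnsteinUhlenbeck

variable {T : Type*} {K : T → T → ℝ} {μ : Measure (T → ℝ)} [IsProbabilityMeasure μ]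

lemma IsCenteredGaussianLaw.map_rotation (hμ : IsCenteredGaussianLaw K μ) {a b : ℝ}
    (hab : a ^ 2 + b ^ 2 = 1) :
    (μ.prod μ).map (fun p => a • p.1 + b • p.2) = μ := by
  conv_rhs => rw [← Measure.map_id (μ := μ)]
  refine map_eq_of_charFun_linear_combinations _ _ (by fun_prop) measurable_id
    fun n c x => ?_
  have h1 : ∀ p : (T → ℝ) × (T → ℝ),
      Complex.exp ((∑ k, c k * (a • p.1 + b • p.2) (x k) : ℝ) * Complex.I)
      = Complex.exp ((∑ k, (a * c k) * p.1 (x k) : ℝ) * Complex.I)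
        * Complex.exp ((∑ k, (b * c k) * p.2 (x k) : ℝ) * Complex.I) := by
    intro p
    rw [← Complex.exp_add, ← add_mul, ← Complex.ofReal_add, ← Finset.sum_add_distrib]
    congr 4
    funext k
    simp only [Pi.add_apply, Pi.smul_apply, smul_eq_mul]
    ring
  simp only [h1, id]
  rw [integral_prod_mul (fun z : T → ℝ =>
      Complex.exp ((∑ k, (a * c k) * z (x k) : ℝ) * Complex.I))
    (fun z : T → ℝ => Complex.exp ((∑ k, (b * c k) * z (x k) : ℝ) * Complex.I)),
    hμ, hμ, hμ, ← Complex.exp_add, ← Complex.ofReal_add]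
  congr 2
  rw [← add_div, ← neg_add, ← Finset.sum_add_distrib]
  congr 2
  refine Finset.sum_congr rfl fun i _ => ?_
  rw [← Finset.sum_add_distrib]
  refine Finset.sum_congr rfl fun j _ => ?_
  linear_combination (c i * c j * K (x i) (x j)) * hab

/-- The Mehler (Ornstein–Uhlenbeck) operator with correlation `σ`. -/
def mehler (μ : Measure (T → ℝ)) (σ : ℝ) (g : (T → ℝ) → ℝ) (z : T → ℝ) : ℝ :=
  ∫ w, g (σ • z + √(1 - σ ^ 2) • w) ∂μ

variable {g : (T → ℝ) → ℝ}

lemma measurable_mehler (hg : Measurable g) (σ : ℝ) : Measurable (mehler μ σ g) := by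
  have : Measurable fun p : (T → ℝ) × (T → ℝ) => g (σ • p.1 + √(1 - σ ^ 2) • p.2) :=
    hg.comp (by fun_prop)
  exact (this.stronglyMeasurable.integral_prod_right (ν := μ)).measurable

lemma abs_mehler_le {C : ℝ} (hC : ∀ z, |g z| ≤ C) (σ : ℝ) (z : T → ℝ) :
    |mehler μ σ g z| ≤ C := by
  have := norm_integral_le_of_norm_le_const (μ := μ)
    (f := fun w => g (σ • z + √(1 - σ ^ 2) • w)) (ae_of_all _ fun w => hC _)
  simpa [mehler] using this

lemma integrable_of_abs_le {α : Type*} [MeasurableSpace α] {P : Measure α} [IsFiniteMeasure P]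
    {h : α → ℝ} (hh : Measurable h) {C : ℝ} (hC : ∀ a, |h a| ≤ C) : Integrable h P :=
  Integrable.of_bound hh.aestronglyMeasurable C (ae_of_all _ hC)

lemma IsCenteredGaussianLaw.integral_rotation (hμ : IsCenteredGaussianLaw K μ)
    (hg : Measurable g) {C : ℝ} (hC : ∀ z, |g z| ≤ C) {a b : ℝ} (hab : a ^ 2 + b ^ 2 = 1) :
    ∫ z, g z ∂μ = ∫ z, ∫ w, g (a • z + b • w) ∂μ ∂μ := by
  have hcomp : Measurable fun p : (T → ℝ) × (T → ℝ) => a • p.1 + b • p.2 := by fun_prop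
  conv_lhs => rw [← hμ.map_rotation hab]
  rw [integral_map hcomp.aemeasurable hg.aestronglyMeasurable, integral_prod]
  exact integrable_of_abs_le (hg.comp hcomp) fun _ => hC _

lemma IsCenteredGaussianLaw.mehler_mul (hμ : IsCenteredGaussianLaw K μ) (hg : Measurable g)
    {C : ℝ} (hC : ∀ z, |g z| ≤ C) {σ τ : ℝ} (hσ0 : 0 ≤ σ) (hσ : σ < 1) (hτ0 : 0 ≤ τ)
    (hτ : τ ≤ 1) (z : T → ℝ) :
    mehler μ (σ * τ) g z = mehler μ τ (mehler μ σ g) z := by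
  have hlt : σ * τ < 1 := by nlinarith
  have hpos : 0 < 1 - (σ * τ) ^ 2 := by
    have : 0 ≤ σ * τ := by positivity
    nlinarith
  set c := √(1 - (σ * τ) ^ 2) with hc
  have hc0 : 0 < c := Real.sqrt_pos.2 hpos
  have hc2 : c ^ 2 = 1 - (σ * τ) ^ 2 := Real.sq_sqrt hpos.le
  have hσ2 : √(1 - σ ^ 2) ^ 2 = 1 - σ ^ 2 := Real.sq_sqrt (by nlinarith)
  have hτ2 : √(1 - τ ^ 2) ^ 2 = 1 - τ ^ 2 := Real.sq_sqrt (by nlinarith)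
  have hab : (σ * √(1 - τ ^ 2) / c) ^ 2 + (√(1 - σ ^ 2) / c) ^ 2 = 1 := by
    rw [div_pow, div_pow, mul_pow, hσ2, hτ2, ← add_div, hc2, div_eq_one_iff_eq hpos.ne']
    ring
  have hm : Measurable fun u : T → ℝ => g ((σ * τ) • z + c • u) := hg.comp (by fun_prop)
  unfold mehler
  rw [← hc, hμ.integral_rotation hm (fun _ => hC _) hab]
  refine integral_congr_ae (ae_of_all _ fun w => integral_congr_ae (ae_of_all _ fun w' => ?_))
  simp only
  congr 1
  funext x
  simp only [Pi.add_apply, Pi.smul_apply, smul_eq_mul]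
  field_simp
  ring

/-- The energy of `mehler μ σ g` is nondecreasing in `σ`. -/
lemma IsCenteredGaussianLaw.integral_sq_mehler_le (hμ : IsCenteredGaussianLaw K μ)
    (hg : Measurable g) {C : ℝ} (hC : ∀ z, |g z| ≤ C) {σ' σ : ℝ} (h0 : 0 ≤ σ') (hle : σ' ≤ σ)
    (hσ : σ < 1) :
    ∫ z, mehler μ σ' g z ^ 2 ∂μ ≤ ∫ z, mehler μ σ g z ^ 2 ∂μ := by
  have hsq : ∀ z, |mehler μ σ g z ^ 2| ≤ C ^ 2 := fun z => by
    rw [abs_pow]; exact pow_le_pow_left₀ (abs_nonneg _) (abs_mehler_le hC σ z) 2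
  have hmm : Measurable fun z => mehler μ σ g z ^ 2 := (measurable_mehler hg σ).pow_const 2
  obtain ⟨τ, hτ0, hτ1, hτ⟩ : ∃ τ, 0 ≤ τ ∧ τ ≤ 1 ∧ σ' = σ * τ := by
    rcases (h0.trans hle).eq_or_lt with h | h
    · exact ⟨0, le_rfl, zero_le_one, by linarith⟩
    · exact ⟨σ' / σ, by positivity, (div_le_one h).2 hle, by field_simp⟩
  have hτ2 : τ ^ 2 + √(1 - τ ^ 2) ^ 2 = 1 := by
    rw [Real.sq_sqrt (by nlinarith)]; ring
  have hcomp : Measurable fun p : (T → ℝ) × (T → ℝ) => τ • p.1 + √(1 - τ ^ 2) • p.2 := by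
    fun_prop
  rw [hμ.integral_rotation hmm hsq hτ2]
  refine integral_mono ?_ ?_ fun z => ?_
  · refine integrable_of_abs_le ((measurable_mehler hg σ').pow_const 2) (C := C ^ 2) fun z => ?_
    rw [abs_pow]; exact pow_le_pow_left₀ (abs_nonneg _) (abs_mehler_le hC σ' z) 2
  · exact (integrable_of_abs_le (P := μ.prod μ) (hmm.comp hcomp) fun _ => hsq _).integral_prod_left
  · simp only
    rw [hτ, hμ.mehler_mul hg hC (h0.trans hle) hσ hτ0 hτ1]
    have hw : Measurable fun w : T → ℝ => τ • z + √(1 - τ ^ 2) • w := by fun_prop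
    exact (even_two.convexOn_pow (𝕜 := ℝ)).map_integral_le
      (continuous_pow 2).continuousOn isClosed_univ (ae_of_all _ fun _ => mem_univ _)
      (integrable_of_abs_le ((measurable_mehler hg σ).comp hw) fun _ => abs_mehler_le hC σ _)
      (integrable_of_abs_le (hmm.comp hw) fun _ => hsq _)

end OrnsteinUhlenbeck

lemma measurable_sumElim {T α : Type*} [MeasurableSpace α] {F G : α → T → ℝ}
    (hF : Measurable F) (hG : Measurable G) :
    Measurable fun a => (Sum.elim (F a) (G a) : T ⊕ T → ℝ) := by
  refine measurable_pi_lambda _ fun y => ?_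
  rcases y with x | x
  · exact (measurable_pi_apply x).comp hF
  · exact (measurable_pi_apply x).comp hG

section Field

variable {q : Plane → ℝ} {Ω : Type*} [MeasurableSpace Ω] {P : Measure Ω}
  {f : Ω → ℝ → Plane → ℝ}

lemma IsDynQField.measurable_eval (hf : IsDynQField P q f) (t : ℝ) (x : Plane) :
    Measurable fun ω => f ω t x :=
  hf.measurable.comp (measurable_id.prodMk (measurable_const (a := (t, x))))

lemma IsDynQField.measurable_field (hf : IsDynQField P q f) (t : ℝ) :
    Measurable fun ω => f ω t :=
  measurable_pi_lambda _ fun x => hf.measurable_eval t x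

lemma IsDynQField.memLp_two (hf : IsDynQField P q f) {t : ℝ} (ht : 0 ≤ t) (x : Plane) :
    MemLp (fun ω => f ω t x) 2 P := by
  obtain ⟨v, hv⟩ := hf.gaussian 1 (fun _ => 1) (fun _ => t) (fun _ => x) fun _ => ht
  simp only [Finset.univ_unique, one_mul, Finset.sum_const, Finset.card_singleton,
    one_smul] at hv
  have := memLp_id_gaussianReal (μ := 0) (v := v) 2
  rw [← hv] at this
  exact (memLp_map_measure_iff (by fun_prop)
    (hf.measurable_eval t x).aemeasurable).1 this

/-- Covariance kernel of the time-zero field. -/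
def spatialKernel (q : Plane → ℝ) (x y : Plane) : ℝ := ∫ z : Plane, q (x - z) * q (y - z)

lemma IsDynQField.integral_cexp (hf : IsDynQField P q f) {n : ℕ} (c : Fin n → ℝ)
    (ts : Fin n → ℝ) (xs : Fin n → Plane) (hts : ∀ i, 0 ≤ ts i) :
    ∫ ω, Complex.exp ((∑ k, c k * f ω (ts k) (xs k) : ℝ) * Complex.I) ∂P
      = Complex.exp ((-(∑ i, ∑ j, c i * c j *
          (Real.exp (-|ts i - ts j|) * spatialKernel q (xs i) (xs j))) / 2 : ℝ)) := by
  obtain ⟨v, hv⟩ := hf.gaussian n c ts xs hts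
  have hS : Measurable fun ω => ∑ k, c k * f ω (ts k) (xs k) :=
    Finset.measurable_sum _ fun k _ => (hf.measurable_eval _ _).const_mul _
  have hchar := charFun_gaussianReal (μ := 0) (v := v) 1
  rw [← hv, charFun_apply_real, integral_map hS.aemeasurable
    (Measurable.aestronglyMeasurable (by fun_prop))] at hchar
  have hvar : (v : ℝ) = ∑ i, ∑ j, c i * c j *
      (Real.exp (-|ts i - ts j|) * spatialKernel q (xs i) (xs j)) := by
    have h1 : ∫ x, x ^ 2 ∂(gaussianReal 0 v) = v := by
      have := variance_fun_id_gaussianReal (μ := 0) (v := v)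
      rw [variance_eq_integral (by fun_prop), integral_id_gaussianReal] at this
      simpa using this
    rw [← h1, ← hv, integral_map hS.aemeasurable (by fun_prop)]
    have hint : ∀ i j, Integrable
        (fun ω => c i * c j * (f ω (ts i) (xs i) * f ω (ts j) (xs j))) P := fun i j =>
      ((hf.memLp_two (hts i) (xs i)).integrable_mul (hf.memLp_two (hts j) (xs j))).const_mul _
    have hexp : ∀ ω, (∑ k, c k * f ω (ts k) (xs k)) ^ 2
        = ∑ i, ∑ j, c i * c j * (f ω (ts i) (xs i) * f ω (ts j) (xs j)) := by
      intro ω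
      rw [sq, Finset.sum_mul_sum]
      exact Finset.sum_congr rfl fun i _ => Finset.sum_congr rfl fun j _ => by ring
    simp only [hexp]
    rw [integral_finsetSum _ fun i _ => integrable_finsetSum _ fun j _ => hint i j]
    refine Finset.sum_congr rfl fun i _ => ?_
    rw [integral_finsetSum _ fun j _ => hint i j]
    refine Finset.sum_congr rfl fun j _ => ?_
    rw [integral_const_mul, hf.covariance _ _ (hts j) (hts i)]
    rfl
  rw [← hvar]
  simp only [Complex.ofReal_one, one_mul] at hchar
  rw [hchar]
  congr 1
  push_cast
  ring

/-- The law of the field at time `0`. -/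
def fieldLaw (P : Measure Ω) (f : Ω → ℝ → Plane → ℝ) : Measure (Plane → ℝ) :=
  P.map fun ω => f ω 0

lemma IsDynQField.isCenteredGaussianLaw (hf : IsDynQField P q f) :
    IsCenteredGaussianLaw (spatialKernel q) (fieldLaw P f) := by
  intro n c x
  rw [fieldLaw, integral_map (hf.measurable_field 0).aemeasurable
    (Measurable.aestronglyMeasurable (by fun_prop)),
    hf.integral_cexp c (fun _ => 0) x fun _ => le_rfl]
  simp

variable [IsProbabilityMeasure P]

lemma IsDynQField.isProbabilityMeasure_fieldLaw (hf : IsDynQField P q f) :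
    IsProbabilityMeasure (fieldLaw P f) :=
  Measure.isProbabilityMeasure_map (hf.measurable_field 0).aemeasurable

/-- Stationarity: the field has the same law at all nonnegative times. -/
lemma IsDynQField.map_eq_fieldLaw (hf : IsDynQField P q f) {t : ℝ} (ht : 0 ≤ t) :
    P.map (fun ω => f ω t) = fieldLaw P f := by
  refine map_eq_of_charFun_linear_combinations _ _ (hf.measurable_field t)
    (hf.measurable_field 0) fun n c x => ?_
  rw [hf.integral_cexp c (fun _ => t) x fun _ => ht,
    hf.integral_cexp c (fun _ => 0) x fun _ => le_rfl]
  simp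

/-- The pair `(f(s,·), f(t,·))` has the law of two conditionally independent copies of the field
given a common part with correlation `σ`, where `σ² = e^{-|s-t|}`. -/
lemma IsDynQField.map_pair (hf : IsDynQField P q f) {s t σ : ℝ} (hs : 0 ≤ s) (ht : 0 ≤ t)
    (hσ : σ ^ 2 = Real.exp (-|s - t|)) :
    P.map (fun ω => (Sum.elim (f ω s) (f ω t) : Plane ⊕ Plane → ℝ))
      = ((fieldLaw P f).prod ((fieldLaw P f).prod (fieldLaw P f))).map
        (fun p => Sum.elim (σ • p.1 + √(1 - σ ^ 2) • p.2.1) (σ • p.1 + √(1 - σ ^ 2) • p.2.2)) := by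
  have := hf.isProbabilityMeasure_fieldLaw
  have hμ := hf.isCenteredGaussianLaw
  set b := √(1 - σ ^ 2) with hb
  have hb2 : b ^ 2 = 1 - σ ^ 2 := Real.sq_sqrt (by
    rw [hσ, sub_nonneg, Real.exp_le_one_iff, neg_nonpos]; exact abs_nonneg _)
  refine map_eq_of_charFun_linear_combinations _ _
    (measurable_sumElim (hf.measurable_field s) (hf.measurable_field t))
    (measurable_sumElim (F := fun p : (Plane → ℝ) × ((Plane → ℝ) × (Plane → ℝ)) => σ • p.1 + b • p.2.1)
      (by fun_prop) (by fun_prop)) fun n c y => ?_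
  set x : Fin n → Plane := fun k => Sum.elim id id (y k) with hx
  set ts : Fin n → ℝ := fun k => Sum.elim (fun _ => s) (fun _ => t) (y k) with hts
  set l : Fin n → ℝ := fun k => Sum.elim (fun _ => 1) (fun _ => 0) (y k) with hl
  set r : Fin n → ℝ := fun k => Sum.elim (fun _ => 0) (fun _ => 1) (y k) with hr
  have hL : ∀ ω k, Sum.elim (f ω s) (f ω t) (y k) = f ω (ts k) (x k) := by
    intro ω k
    simp only [hts, hx]
    rcases y k <;> rfl
  have hR : ∀ p : (Plane → ℝ) × ((Plane → ℝ) × (Plane → ℝ)), Complex.exp ((∑ k, c k *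
      (Sum.elim (σ • p.1 + b • p.2.1) (σ • p.1 + b • p.2.2) : Plane ⊕ Plane → ℝ) (y k) : ℝ)
        * Complex.I)
      = Complex.exp ((∑ k, (σ * c k) * p.1 (x k) : ℝ) * Complex.I)
        * (Complex.exp ((∑ k, (b * l k * c k) * p.2.1 (x k) : ℝ) * Complex.I)
          * Complex.exp ((∑ k, (b * r k * c k) * p.2.2 (x k) : ℝ) * Complex.I)) := by
    intro p
    rw [← Complex.exp_add, ← Complex.exp_add, ← add_mul, ← add_mul, ← Complex.ofReal_add,
      ← Complex.ofReal_add, ← Finset.sum_add_distrib, ← Finset.sum_add_distrib]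
    congr 4
    funext k
    simp only [hl, hr, hx]
    rcases y k with u | u <;>
      simp only [Sum.elim_inl, Sum.elim_inr, Pi.add_apply, Pi.smul_apply, smul_eq_mul, id] <;> ring
  simp only [hL, hR]
  rw [integral_prod_mul (fun z : Plane → ℝ =>
      Complex.exp ((∑ k, (σ * c k) * z (x k) : ℝ) * Complex.I))
    (fun p : (Plane → ℝ) × (Plane → ℝ) =>
      Complex.exp ((∑ k, (b * l k * c k) * p.1 (x k) : ℝ) * Complex.I)
        * Complex.exp ((∑ k, (b * r k * c k) * p.2 (x k) : ℝ) * Complex.I)),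
    integral_prod_mul (fun z : Plane → ℝ =>
      Complex.exp ((∑ k, (b * l k * c k) * z (x k) : ℝ) * Complex.I))
    (fun z : Plane → ℝ => Complex.exp ((∑ k, (b * r k * c k) * z (x k) : ℝ) * Complex.I)),
    hμ, hμ, hμ, ← Complex.exp_add, ← Complex.exp_add, ← Complex.ofReal_add,
    ← Complex.ofReal_add, hf.integral_cexp c ts x]
  · congr 2
    rw [← add_div, ← neg_add, ← add_div, ← neg_add, ← Finset.sum_add_distrib,
      ← Finset.sum_add_distrib]
    congr 2
    refine Finset.sum_congr rfl fun i _ => ?_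
    rw [← Finset.sum_add_distrib, ← Finset.sum_add_distrib]
    refine Finset.sum_congr rfl fun j _ => ?_
    have hcorr : Real.exp (-|ts i - ts j|) = σ ^ 2 + b ^ 2 * (l i * l j + r i * r j) := by
      simp only [hts, hl, hr]
      rcases y i with u | u <;> rcases y j with w | w <;>
        simp [hb2, hσ, abs_sub_comm t s]
    rw [hcorr]
    ring
  · intro k
    simp only [hts]
    rcases y k <;> assumption

/-- The two-time correlation of an observable is an energy of the Mehler operator. -/
lemma IsDynQField.integral_mul_eq (hf : IsDynQField P q f) {g : (Plane → ℝ) → ℝ}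
    (hg : Measurable g) {C : ℝ} (hC : ∀ z, |g z| ≤ C) {s t σ : ℝ} (hs : 0 ≤ s) (ht : 0 ≤ t)
    (hσ : σ ^ 2 = Real.exp (-|s - t|)) :
    ∫ ω, g (f ω s) * g (f ω t) ∂P
      = ∫ z, mehler (fieldLaw P f) σ g z ^ 2 ∂(fieldLaw P f) := by
  have := hf.isProbabilityMeasure_fieldLaw
  have hleft : Measurable fun (y : Plane ⊕ Plane → ℝ) (x : Plane) => y (Sum.inl x) := by fun_prop
  have hright : Measurable fun (y : Plane ⊕ Plane → ℝ) (x : Plane) => y (Sum.inr x) := by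
    fun_prop
  have hG : Measurable fun y : Plane ⊕ Plane → ℝ =>
      g (fun x => y (Sum.inl x)) * g (fun x => y (Sum.inr x)) :=
    (hg.comp hleft).mul (hg.comp hright)
  have h1 := integral_map (μ := P)
    (measurable_sumElim (hf.measurable_field s) (hf.measurable_field t)).aemeasurable
    hG.aestronglyMeasurable
  simp only [Sum.elim_inl, Sum.elim_inr] at h1
  rw [← h1, hf.map_pair hs ht hσ, integral_map
    (measurable_sumElim (F := fun p : (Plane → ℝ) × ((Plane → ℝ) × (Plane → ℝ)) => σ • p.1 + √(1 - σ ^ 2) • p.2.1)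
      (by fun_prop) (by fun_prop)).aemeasurable hG.aestronglyMeasurable]
  simp only [Sum.elim_inl, Sum.elim_inr]
  have hFl : Measurable fun p : (Plane → ℝ) × (Plane → ℝ) =>
      g (σ • p.1 + √(1 - σ ^ 2) • p.2) := hg.comp (by fun_prop)
  rw [integral_prod]
  · refine integral_congr_ae (ae_of_all _ fun z => ?_)
    simp only
    rw [integral_prod_mul (fun w => g (σ • z + √(1 - σ ^ 2) • w))
      (fun w => g (σ • z + √(1 - σ ^ 2) • w))]
    exact (sq _).symm
  · refine integrable_of_abs_le (C := C * C) ?_ fun p => ?_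
    · exact (hFl.comp (measurable_fst.prodMk (measurable_fst.comp measurable_snd))).mul
        (hFl.comp (measurable_fst.prodMk (measurable_snd.comp measurable_snd)))
    · rw [abs_mul]
      exact mul_le_mul (hC _) (hC _) (abs_nonneg _) ((abs_nonneg _).trans (hC 0))

lemma IsDynQField.integral_mul_nonneg (hf : IsDynQField P q f) {g : (Plane → ℝ) → ℝ}
    (hg : Measurable g) {C : ℝ} (hC : ∀ z, |g z| ≤ C) {s t : ℝ} (hs : 0 ≤ s) (ht : 0 ≤ t) :
    0 ≤ ∫ ω, g (f ω s) * g (f ω t) ∂P := by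
  rw [hf.integral_mul_eq hg hC hs ht (σ := Real.exp (-|s - t| / 2))
    (by rw [← Real.exp_nat_mul]; congr 1; push_cast; ring)]
  exact integral_nonneg fun _ => sq_nonneg _

/-- Two-time correlations decrease as the time separation grows. -/
lemma IsDynQField.integral_mul_le (hf : IsDynQField P q f) {g : (Plane → ℝ) → ℝ}
    (hg : Measurable g) {C : ℝ} (hC : ∀ z, |g z| ≤ C) {s t r : ℝ} (hs : 0 ≤ s) (ht : 0 ≤ t)
    (hr : 0 < r) (hst : r ≤ |s - t|) :
    ∫ ω, g (f ω s) * g (f ω t) ∂P ≤ ∫ ω, g (f ω 0) * g (f ω r) ∂P := by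
  have := hf.isProbabilityMeasure_fieldLaw
  rw [hf.integral_mul_eq hg hC hs ht (σ := Real.exp (-|s - t| / 2))
      (by rw [← Real.exp_nat_mul]; congr 1; push_cast; ring),
    hf.integral_mul_eq hg hC le_rfl hr.le (σ := Real.exp (-|0 - r| / 2))
      (by rw [← Real.exp_nat_mul]; congr 1; push_cast; ring)]
  have h0 : |0 - r| = r := by rw [zero_sub, abs_neg, abs_of_pos hr]
  rw [h0]
  refine hf.isCenteredGaussianLaw.integral_sq_mehler_le hg hC (Real.exp_pos _).le ?_ ?_
  · exact Real.exp_le_exp.2 (by linarith)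
  · rw [Real.exp_lt_one_iff]; linarith

/-- Second moment bound for sums of an observable over separated times. -/
lemma IsDynQField.integral_sq_sum_le (hf : IsDynQField P q f) {g : (Plane → ℝ) → ℝ}
    (hg : Measurable g) (hC : ∀ z, |g z| ≤ 1) {r : ℝ} (hr : 0 < r) (M : ℕ) {τ : ℕ → ℝ}
    (hτ0 : ∀ i, 0 ≤ τ i) (hτ : ∀ i j, i ≠ j → r ≤ |τ i - τ j|) :
    ∫ ω, (∑ i ∈ Finset.range M, g (f ω (τ i))) ^ 2 ∂P
      ≤ M + M ^ 2 * ∫ ω, g (f ω 0) * g (f ω r) ∂P := by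
  have hgm : ∀ t, Measurable fun ω => g (f ω t) := fun t => hg.comp (hf.measurable_field t)
  have hle : ∀ i j ω, |g (f ω (τ i)) * g (f ω (τ j))| ≤ 1 := fun i j ω => by
    rw [abs_mul]; exact mul_le_one₀ (hC _) (abs_nonneg _) (hC _)
  have hint : ∀ i j, Integrable (fun ω => g (f ω (τ i)) * g (f ω (τ j))) P := fun i j =>
    integrable_of_abs_le ((hgm _).mul (hgm _)) (hle i j)
  set D := ∫ ω, g (f ω 0) * g (f ω r) ∂P with hD
  have hD0 : 0 ≤ D := hf.integral_mul_nonneg hg hC le_rfl hr.le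
  simp only [sq, Finset.sum_mul_sum]
  rw [integral_finsetSum _ fun i _ => integrable_finsetSum _ fun j _ => hint i j]
  calc ∑ i ∈ Finset.range M, ∫ ω, ∑ j ∈ Finset.range M, g (f ω (τ i)) * g (f ω (τ j)) ∂P
      ≤ ∑ i ∈ Finset.range M, (1 + M * D) := by
        refine Finset.sum_le_sum fun i hi => ?_
        rw [integral_finsetSum _ fun j _ => hint i j]
        calc ∑ j ∈ Finset.range M, ∫ ω, g (f ω (τ i)) * g (f ω (τ j)) ∂P
            ≤ ∑ j ∈ Finset.range M, ((if i = j then 1 else 0) + D) := by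
              refine Finset.sum_le_sum fun j _ => ?_
              split_ifs with hij
              · have : ∫ ω, g (f ω (τ i)) * g (f ω (τ j)) ∂P ≤ ∫ _, (1 : ℝ) ∂P :=
                  integral_mono (hint i j) (integrable_const _)
                    fun ω => (le_abs_self _).trans (hle i j ω)
                simp only [integral_const, probReal_univ, smul_eq_mul, mul_one] at this
                linarith
              · rw [zero_add]
                exact hf.integral_mul_le hg hC (hτ0 i) (hτ0 j) hr (hτ i j hij)
          _ = 1 + M * D := by
              rw [Finset.sum_add_distrib, Finset.sum_ite_eq, if_pos hi]
              simp
    _ = M + M * M * D := by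
        simp only [Finset.sum_const, Finset.card_range, nsmul_eq_mul]
        ring

/-- The centered indicator function of `B`. -/
def centeredIndicator (B : Set (Plane → ℝ)) (p : ℝ) (z : Plane → ℝ) : ℝ :=
  B.indicator (fun _ => 1) z - p

lemma centeredIndicator_of_mem {B : Set (Plane → ℝ)} {z : Plane → ℝ} (hz : z ∈ B) (p : ℝ) :
    centeredIndicator B p z = 1 - p := by simp [centeredIndicator, hz]

lemma centeredIndicator_of_notMem {B : Set (Plane → ℝ)} {z : Plane → ℝ} (hz : z ∉ B) (p : ℝ) :
    centeredIndicator B p z = -p := by simp [centeredIndicator, hz]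

lemma IsDynQField.integral_centeredIndicator_mul (hf : IsDynQField P q f)
    {B : Set (Plane → ℝ)} (hB : MeasurableSet B) {r : ℝ} (hr : 0 ≤ r) :
    ∫ ω, centeredIndicator B (P {ω | f ω 0 ∈ B}).toReal (f ω 0)
        * centeredIndicator B (P {ω | f ω 0 ∈ B}).toReal (f ω r) ∂P
      = covIndicator P {ω | f ω 0 ∈ B} {ω | f ω r ∈ B} := by
  have h0 : MeasurableSet {ω | f ω 0 ∈ B} := hf.measurable_field 0 hB
  have h1 : MeasurableSet {ω | f ω r ∈ B} := hf.measurable_field r hB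
  have heq : P {ω | f ω r ∈ B} = P {ω | f ω 0 ∈ B} := by
    have := congrArg (fun ν => ν B) (hf.map_eq_fieldLaw hr)
    simp only [fieldLaw] at this
    rwa [Measure.map_apply (hf.measurable_field r) hB,
      Measure.map_apply (hf.measurable_field 0) hB] at this
  rw [covIndicator, heq]
  set p := (P {ω | f ω 0 ∈ B}).toReal with hp
  have hexp : ∀ ω, centeredIndicator B p (f ω 0) * centeredIndicator B p (f ω r)
      = ({ω | f ω 0 ∈ B} ∩ {ω | f ω r ∈ B}).indicator (fun _ => (1 : ℝ)) ω
        - p * {ω | f ω 0 ∈ B}.indicator (fun _ => (1 : ℝ)) ω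
        - p * {ω | f ω r ∈ B}.indicator (fun _ => (1 : ℝ)) ω + p * p := by
    intro ω
    by_cases ha : f ω 0 ∈ B <;> by_cases hb : f ω r ∈ B <;>
      simp [centeredIndicator, Set.indicator, ha, hb] <;> ring
  have hi : ∀ {S : Set Ω}, MeasurableSet S → Integrable (S.indicator fun _ => (1 : ℝ)) P :=
    fun hS => (integrable_const _).indicator hS
  have hv : ∀ {S : Set Ω}, MeasurableSet S →
      ∫ ω, S.indicator (fun _ => (1 : ℝ)) ω ∂P = (P S).toReal := fun hS => by
    rw [integral_indicator_const _ hS]; simp [Measure.real]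
  simp only [hexp]
  rw [integral_add, integral_sub, integral_sub, integral_const_mul, integral_const_mul,
    hv (h0.inter h1), hv h0, hv h1, heq, ← hp]
  · simp
  · exact hi (h0.inter h1)
  · exact (hi h0).const_mul _
  · exact (hi (h0.inter h1)).sub ((hi h0).const_mul _)
  · exact (hi h1).const_mul _
  · exact ((hi (h0.inter h1)).sub ((hi h0).const_mul _)).sub ((hi h1).const_mul _)
  · exact integrable_const _

/-- Quantitative lower bound on the probability of at least `k` switches, obtained by sampling
the field at `M` times in each of `2k` consecutive windows. -/
lemma IsDynQField.le_prob_switches (hf : IsDynQField P q f) {B : Set (Plane → ℝ)}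
    (hB : MeasurableSet B) {ε r S : ℝ} (hε : 0 < ε) (hr : 0 < r)
    (hlow : ε ≤ (P {ω | f ω 0 ∈ B}).toReal) (hup : (P {ω | f ω 0 ∈ B}).toReal ≤ 1 - ε)
    {k M : ℕ} (hM : 0 < M) (hS : 2 * k * M * r ≤ S) :
    1 - 2 * k * ((1 / M + covIndicator P {ω | f ω 0 ∈ B} {ω | f ω r ∈ B}) / ε ^ 2)
      ≤ (P {ω | ∃ u v : Fin k → ℝ,
        (∀ i, 0 ≤ u i) ∧ (∀ i, u i < v i) ∧ (∀ i j : Fin k, i < j → v i < u j) ∧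
        (∀ i, v i ≤ S) ∧ (∀ i, f ω (u i) ∉ B ∧ f ω (v i) ∈ B)}).toReal := by
  rw [← hf.integral_centeredIndicator_mul hB hr.le]
  set p := (P {ω | f ω 0 ∈ B}).toReal with hp
  set g := centeredIndicator B p with hgdef
  have hM' : (0 : ℝ) < M := by exact_mod_cast hM
  have hg : Measurable g := (measurable_const.indicator hB).sub_const p
  have hg1 : ∀ z, |g z| ≤ 1 := by
    intro z
    rw [abs_le]
    by_cases hz : z ∈ B <;> simp [hgdef, centeredIndicator, hz] <;> constructor <;> linarith
  set D := ∫ ω, g (f ω 0) * g (f ω r) ∂P with hD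
  set W : ℕ → Ω → ℝ := fun w ω => ∑ i ∈ Finset.range M, g (f ω (((w * M + i : ℕ) : ℝ) * r))
    with hW
  have hWm : ∀ w, Measurable (W w) := fun w =>
    Finset.measurable_sum _ fun i _ => hg.comp (hf.measurable_field _)
  have hbad : ∀ w, P.real {ω | (M * ε) ^ 2 ≤ W w ω ^ 2} ≤ (1 / M + D) / ε ^ 2 := by
    intro w
    have hint : Integrable (fun ω => W w ω ^ 2) P := by
      refine integrable_of_abs_le ((hWm w).pow_const 2) (C := (M : ℝ) ^ 2) fun ω => ?_
      rw [abs_pow]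
      refine pow_le_pow_left₀ (abs_nonneg _) ?_ 2
      refine (Finset.abs_sum_le_sum_abs _ _).trans ?_
      refine (Finset.sum_le_sum fun i _ => hg1 _).trans ?_
      simp
    have h1 := mul_meas_ge_le_integral_of_nonneg (μ := P)
      (ae_of_all _ fun ω => sq_nonneg (W w ω)) hint ((M * ε) ^ 2)
    have h2 : ∫ ω, W w ω ^ 2 ∂P ≤ M + M ^ 2 * D := by
      refine hf.integral_sq_sum_le hg hg1 hr M (fun i => by positivity) fun i j hij => ?_
      rw [← sub_mul, abs_mul, abs_of_pos hr]
      have h3 : (1 : ℝ) ≤ |((w * M + i : ℕ) : ℝ) - ((w * M + j : ℕ) : ℝ)| := by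
        have : ((w * M + i : ℕ) : ℤ) - ((w * M + j : ℕ) : ℤ) ≠ 0 := by omega
        exact_mod_cast Int.one_le_abs this
      nlinarith
    rw [le_div_iff₀ (by positivity)]
    have h4 : (M : ℝ) ^ 2 * (P.real {ω | (M * ε) ^ 2 ≤ W w ω ^ 2} * ε ^ 2)
        ≤ (M : ℝ) ^ 2 * (1 / M + D) := by
      have : (M : ℝ) ^ 2 * (1 / M + D) = M + M ^ 2 * D := by field_simp
      rw [this]
      calc _ = (M * ε) ^ 2 * P.real {ω | (M * ε) ^ 2 ≤ W w ω ^ 2} := by ring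
        _ ≤ _ := h1.trans h2
    exact le_of_mul_le_mul_left h4 (by positivity)
  have hbm : MeasurableSet (⋃ w ∈ Finset.range (2 * k), {ω | (M * ε) ^ 2 ≤ W w ω ^ 2}) :=
    Finset.measurableSet_biUnion _ fun w _ =>
      measurableSet_le measurable_const ((hWm w).pow_const 2)
  have hunion : P.real (⋃ w ∈ Finset.range (2 * k), {ω | (M * ε) ^ 2 ≤ W w ω ^ 2})
      ≤ 2 * k * ((1 / M + D) / ε ^ 2) := by
    refine (measureReal_biUnion_finset_le _ _).trans ?_
    refine (Finset.sum_le_sum fun w _ => hbad w).trans ?_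
    simp
  have hgood := probReal_compl_eq_one_sub (μ := P) hbm
  have hexit : ∀ ω ∈ (⋃ w ∈ Finset.range (2 * k), {ω | (M * ε) ^ 2 ≤ W w ω ^ 2})ᶜ,
      ∀ w < 2 * k, (∃ i < M, f ω (((w * M + i : ℕ) : ℝ) * r) ∉ B) ∧
        ∃ i < M, f ω (((w * M + i : ℕ) : ℝ) * r) ∈ B := by
    intro ω hω w hw
    have hlt : W w ω ^ 2 < (M * ε) ^ 2 := by
      by_contra! hcon
      exact hω (mem_biUnion (Finset.mem_coe.2 (Finset.mem_range.2 hw)) hcon)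
    constructor
    · by_contra! hcon
      have : W w ω = M * (1 - p) := by
        simp only [hW]
        rw [Finset.sum_congr rfl fun i hi =>
          centeredIndicator_of_mem (hcon i (Finset.mem_range.1 hi)) p]
        simp only [Finset.sum_const, Finset.card_range, nsmul_eq_mul]
      rw [this] at hlt
      exact hlt.not_ge (pow_le_pow_left₀ (by positivity)
        (mul_le_mul_of_nonneg_left (by linarith) hM'.le) 2)
    · by_contra! hcon
      have : W w ω = -(M * p) := by
        simp only [hW]
        rw [Finset.sum_congr rfl fun i hi =>
          centeredIndicator_of_notMem (hcon i (Finset.mem_range.1 hi)) p]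
        simp only [Finset.sum_const, Finset.card_range, nsmul_eq_mul]
        ring
      rw [this, neg_sq] at hlt
      exact hlt.not_ge (pow_le_pow_left₀ (by positivity)
        (mul_le_mul_of_nonneg_left (by linarith) hM'.le) 2)
  have hsub : (⋃ w ∈ Finset.range (2 * k), {ω | (M * ε) ^ 2 ≤ W w ω ^ 2})ᶜ ⊆
      {ω | ∃ u v : Fin k → ℝ,
        (∀ i, 0 ≤ u i) ∧ (∀ i, u i < v i) ∧ (∀ i j : Fin k, i < j → v i < u j) ∧
        (∀ i, v i ≤ S) ∧ (∀ i, f ω (u i) ∉ B ∧ f ω (v i) ∈ B)} := by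
    intro ω hω
    have hx := hexit ω hω
    choose a ha haB using fun i : Fin k => (hx (2 * i) (by omega)).1
    choose b hb hbB using fun i : Fin k => (hx (2 * i + 1) (by omega)).2
    have hmono : ∀ {m n : ℕ}, m < n → (m : ℝ) * r < (n : ℝ) * r := fun h =>
      mul_lt_mul_of_pos_right (by exact_mod_cast h) hr
    refine ⟨fun i => ((2 * i * M + a i : ℕ) : ℝ) * r,
      fun i => (((2 * i + 1) * M + b i : ℕ) : ℝ) * r, fun i => by positivity,
      fun i => hmono ?_, fun i j hij => hmono ?_, fun i => ?_, fun i => ⟨haB i, hbB i⟩⟩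
    · have := ha i
      rw [add_mul]
      omega
    · have h1 := hb i
      have h2 : ((2 * i + 1 + 1 : ℕ)) * M ≤ 2 * j * M :=
        Nat.mul_le_mul_right _ (by have : (i : ℕ) < j := hij; omega)
      rw [add_mul (2 * (i : ℕ) + 1)] at h2
      omega
    · have h1 := hb i
      have h2 : ((2 * i + 1 + 1 : ℕ)) * M ≤ 2 * k * M :=
        Nat.mul_le_mul_right _ (by omega)
      rw [add_mul (2 * (i : ℕ) + 1)] at h2
      have h3 := hmono (show (2 * i + 1) * M + b i < 2 * k * M by omega)
      push_cast at h3 ⊢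
      linarith
  have hfin := measureReal_mono (μ := P) hsub
  rw [hgood] at hfin
  simp only [Measure.real] at hfin hunion
  linarith

end Field

/-- **Noise sensitivity implies many switches.** Let `f` be a dynamical `q`-field with `q`
satisfying Condition (Weak). If `Cov(1_{f(0) ∈ A_n}, 1_{f(t_n) ∈ A_n}) → 0`, the
probabilities `P[f(0) ∈ A_n]` are bounded away from `0` and `1`, and `t_n/s_n → 0`, then for
every `k ≥ 1` the probability that the process `t ↦ 1_{f(t) ∈ A_n}` switches from `0` to `1`
at least `k` times during `[0, s_n]` tends to `1`. -/
theorem many_switches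
    (q : Plane → ℝ) (hq : CondWeak q)
    {Ω : Type*} [MeasurableSpace Ω] (P : Measure Ω) [IsProbabilityMeasure P]
    (f : Ω → ℝ → Plane → ℝ) (hf : IsDynQField P q f)
    (A : ℕ → Set (Plane → ℝ)) (hA : ∀ n, MeasurableSet (A n))
    (t s : ℕ → ℝ) (ht : ∀ n, 0 < t n) (hs : ∀ n, 0 < s n)
    (hcov : Filter.Tendsto
      (fun n => covIndicator P {ω | f ω 0 ∈ A n} {ω | f ω (t n) ∈ A n})
      Filter.atTop (nhds 0))
    (hbdd : ∃ ε > (0 : ℝ), ∀ n,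
      ε ≤ (P {ω | f ω 0 ∈ A n}).toReal ∧ (P {ω | f ω 0 ∈ A n}).toReal ≤ 1 - ε)
    (hts : Filter.Tendsto (fun n => t n / s n) Filter.atTop (nhds 0))
    (k : ℕ) (hk : 1 ≤ k) :
    Filter.Tendsto
      (fun n => (P {ω | ∃ u v : Fin k → ℝ,
        (∀ i, 0 ≤ u i) ∧ (∀ i, u i < v i) ∧ (∀ i j : Fin k, i < j → v i < u j) ∧
        (∀ i, v i ≤ s n) ∧ (∀ i, f ω (u i) ∉ A n ∧ f ω (v i) ∈ A n)}).toReal)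
      Filter.atTop (nhds 1) := by
  obtain ⟨ε, hε, hb⟩ := hbdd
  rw [Metric.tendsto_atTop]
  intro η hη
  obtain ⟨M, hM⟩ := exists_nat_gt (2 * k * 2 / (ε ^ 2 * η))
  have hk' : (0 : ℝ) < k := by exact_mod_cast hk
  have hM0 : (0 : ℝ) < M := lt_trans (by positivity) hM
  have h1 : 2 * k * ((1 / M : ℝ) / ε ^ 2) < η / 2 := by
    rw [div_lt_iff₀ (by positivity)] at hM
    have : 2 * k * ((1 / M : ℝ) / ε ^ 2) = (2 * k * 2) / (M * (ε ^ 2 * 2)) := by field_simp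
    rw [this, div_lt_iff₀ (by positivity)]
    linarith
  have h2 : ∀ᶠ n in Filter.atTop,
      covIndicator P {ω | f ω 0 ∈ A n} {ω | f ω (t n) ∈ A n} < η * ε ^ 2 / (4 * k) :=
    hcov.eventually_lt_const (by positivity)
  have h3 : ∀ᶠ n in Filter.atTop, t n / s n < 1 / (2 * k * M) :=
    hts.eventually_lt_const (by positivity)
  obtain ⟨N, hN⟩ := Filter.eventually_atTop.1 (h2.and h3)
  refine ⟨N, fun n hn => ?_⟩
  obtain ⟨h2, h3⟩ := hN n hn
  rw [div_lt_div_iff₀ (hs n) (by positivity)] at h3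
  have hlow := hf.le_prob_switches (hA n) hε (ht n) (hb n).1 (hb n).2 (k := k) (M := M)
    (by exact_mod_cast hM0) (S := s n) (by linarith)
  have hup := measureReal_le_one (μ := P) (s := {ω | ∃ u v : Fin k → ℝ,
        (∀ i, 0 ≤ u i) ∧ (∀ i, u i < v i) ∧ (∀ i j : Fin k, i < j → v i < u j) ∧
        (∀ i, v i ≤ s n) ∧ (∀ i, f ω (u i) ∉ A n ∧ f ω (v i) ∈ A n)})
  simp only [Measure.real] at hup
  rw [lt_div_iff₀ (by positivity)] at h2
  have h4 : 2 * k * (covIndicator P {ω | f ω 0 ∈ A n} {ω | f ω (t n) ∈ A n} / ε ^ 2)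
      < η / 2 := by
    rw [← mul_div_assoc, div_lt_iff₀ (by positivity)]
    linarith
  rw [add_div, mul_add] at hlow
  rw [Real.dist_eq, abs_lt]
  constructor <;> linarith

end
end

section
/- Let q : ℝ² → ℝ satisfy Condition (Weak) with constants c, δ and let f be a dynamical q-field. Then for every a ∈ (0,1) there exist constants C, C′, κ > 0 depending only on a, c, δ such that for every h ∈ [0,1]: P[ sup_{t ∈ [0,h], x ∈ [0,1]²} |f(t,x) − f(0,x)| ≥ C h^{(1−a)/2} ] ≤ C′ exp(−κ h^{−a}). -/
open MeasureTheory Set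
open scoped ENNReal NNReal

noncomputable section

/-- Condition (Weak) with explicit constants `c, δ`: `q` is `C²` with all derivatives up to
order 2 bounded by `c (1 ∨ |x|)^{-(1+δ)}`. -/
def CondWeakWith (c δ : ℝ) (q : Plane → ℝ) : Prop :=
  ContDiff ℝ 2 q ∧ ∀ k : ℕ, k ≤ 2 → ∀ x : Plane,
    ‖iteratedFDeriv ℝ k q x‖ ≤ c * max 1 ‖x‖ ^ (-(1 + δ))

/-- The polynomially decaying envelope of `q` and its first derivative under Condition (Weak),
enlarged so that it also controls increments of `q` over distances up to `2`. -/
def decayEnvelope (c δ : ℝ) (w : Plane) : ℝ :=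
  c * 3 ^ (1 + δ) * max 1 ‖w‖ ^ (-(1 + δ))

/-- A variance bound for fields satisfying Condition (Weak) with constants `c, δ`. -/
def varianceBound (c δ : ℝ) : ℝ := 1 + ∫ w, decayEnvelope c δ w ^ 2

lemma varianceBound_pos (c δ : ℝ) : 0 < varianceBound c δ := by
  have : 0 ≤ ∫ w, decayEnvelope c δ w ^ 2 := integral_nonneg fun w => sq_nonneg _
  unfold varianceBound
  linarith

lemma continuous_decayEnvelope (c δ : ℝ) : Continuous (decayEnvelope c δ) := by
  unfold decayEnvelope
  refine continuous_const.mul ?_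
  refine (continuous_const.max continuous_norm).rpow_const fun w => Or.inl ?_
  exact (lt_of_lt_of_le one_pos (le_max_left _ _)).ne'

lemma integrable_decayEnvelope_sq (c : ℝ) {δ : ℝ} (hδ : 0 < δ) :
    Integrable fun w => decayEnvelope c δ w ^ 2 := by
  have hI : Integrable (fun w : Plane => (1 + ‖w‖) ^ (-(2 * (1 + δ)))) := by
    apply integrable_one_add_norm
    simp only [finrank_euclideanSpace, Fintype.card_fin, Nat.cast_ofNat]
    linarith
  refine (hI.const_mul ((c * 3 ^ (1 + δ)) ^ 2 * (1 / 2 : ℝ) ^ (-(2 * (1 + δ))))).mono'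
    ((continuous_decayEnvelope c δ).pow 2).aestronglyMeasurable (.of_forall fun w => ?_)
  have h1 : (0 : ℝ) < max 1 ‖w‖ := lt_of_lt_of_le one_pos (le_max_left _ _)
  have h2 : 1 / 2 * (1 + ‖w‖) ≤ max 1 ‖w‖ := by
    have := le_max_left 1 ‖w‖
    have := le_max_right 1 ‖w‖
    linarith
  have h3 : (max 1 ‖w‖ ^ (-(1 + δ))) ^ 2 ≤
      (1 / 2 : ℝ) ^ (-(2 * (1 + δ))) * (1 + ‖w‖) ^ (-(2 * (1 + δ))) := by
    rw [← Real.mul_rpow (by norm_num) (by positivity), ← Real.rpow_natCast, ← Real.rpow_mul h1.le]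
    have he : -(1 + δ) * ((2 : ℕ) : ℝ) = -(2 * (1 + δ)) := by push_cast; ring
    rw [he]
    exact Real.rpow_le_rpow_of_nonpos (by positivity) h2 (by linarith)
  rw [Real.norm_of_nonneg (sq_nonneg _), decayEnvelope, mul_pow, mul_assoc]
  gcongr

namespace CondWeakWith

variable {c δ : ℝ} {q : Plane → ℝ}

lemma abs_le (hq : CondWeakWith c δ q) (hc : 0 < c) (hδ : 0 < δ) (w : Plane) :
    |q w| ≤ decayEnvelope c δ w := by
  have h0 := hq.2 0 (by norm_num) w
  rw [norm_iteratedFDeriv_zero, Real.norm_eq_abs] at h0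
  refine h0.trans ?_
  have h3 : (1 : ℝ) ≤ 3 ^ (1 + δ) := Real.one_le_rpow (by norm_num) (by linarith)
  unfold decayEnvelope
  gcongr
  nlinarith

lemma abs_sub_le (hq : CondWeakWith c δ q) (hc : 0 < c) (hδ : 0 < δ) {u w : Plane}
    (huw : ‖u - w‖ ≤ 2) : |q u - q w| ≤ ‖u - w‖ * decayEnvelope c δ u := by
  have hd : Differentiable ℝ q := hq.1.differentiable (by norm_num)
  have hbound : ∀ y ∈ Metric.closedBall u 2, ‖fderiv ℝ q y‖ ≤ decayEnvelope c δ u := by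
    intro y hy
    have h1 := hq.2 1 (by norm_num) y
    rw [norm_iteratedFDeriv_one] at h1
    refine h1.trans ?_
    have hu : ‖u‖ ≤ ‖y‖ + 2 := by
      have := norm_le_norm_add_norm_sub' u y
      rw [mem_closedBall_iff_norm'] at hy
      linarith
    have hle : max 1 ‖u‖ / 3 ≤ max 1 ‖y‖ := by
      have h2 := le_max_left 1 ‖y‖
      have h3 := le_max_right 1 ‖y‖
      rw [div_le_iff₀ (by norm_num)]
      exact max_le (by linarith) (by linarith)
    have hpos : 0 < max 1 ‖u‖ := lt_of_lt_of_le one_pos (le_max_left _ _)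
    have := Real.rpow_le_rpow_of_nonpos (by positivity) hle (by linarith : -(1 + δ) ≤ 0)
    rw [Real.div_rpow hpos.le (by norm_num), Real.rpow_neg (by norm_num : (0 : ℝ) ≤ 3),
      div_inv_eq_mul] at this
    unfold decayEnvelope
    calc c * max 1 ‖y‖ ^ (-(1 + δ)) ≤ c * (max 1 ‖u‖ ^ (-(1 + δ)) * 3 ^ (1 + δ)) := by gcongr
      _ = _ := by ring
  have := (convex_closedBall u 2).norm_image_sub_le_of_norm_fderiv_le
    (fun y _ => hd y) hbound (x := w) (y := u)
    (by rw [mem_closedBall_iff_norm']; exact huw) (Metric.mem_closedBall_self (by norm_num))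
  rw [Real.norm_eq_abs] at this
  linarith [mul_comm ‖u - w‖ (decayEnvelope c δ u)]

lemma memLp_two (hq : CondWeakWith c δ q) (hc : 0 < c) (hδ : 0 < δ) : MemLp q 2 := by
  rw [memLp_two_iff_integrable_sq hq.1.continuous.aestronglyMeasurable]
  refine (integrable_decayEnvelope_sq c hδ).mono'
    (hq.1.continuous.pow 2).aestronglyMeasurable (.of_forall fun w => ?_)
  rw [Real.norm_of_nonneg (sq_nonneg _)]
  exact sq_le_sq' (neg_le_of_abs_le (hq.abs_le hc hδ w)) (le_of_abs_le (hq.abs_le hc hδ w))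

lemma memLp_two_comp_sub (hq : CondWeakWith c δ q) (hc : 0 < c) (hδ : 0 < δ) (x : Plane) :
    MemLp (fun z => q (x - z)) 2 :=
  (hq.memLp_two hc hδ).comp_measurePreserving (Measure.measurePreserving_sub_left volume x)

lemma integral_sq_le (hq : CondWeakWith c δ q) (hc : 0 < c) (hδ : 0 < δ) :
    ∫ w, q w ^ 2 ≤ varianceBound c δ := by
  have : ∫ w, q w ^ 2 ≤ ∫ w, decayEnvelope c δ w ^ 2 := by
    refine integral_mono (hq.memLp_two hc hδ).integrable_sq (integrable_decayEnvelope_sq c hδ)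
      fun w => ?_
    exact sq_le_sq' (neg_le_of_abs_le (hq.abs_le hc hδ w)) (le_of_abs_le (hq.abs_le hc hδ w))
  unfold varianceBound
  linarith

lemma integral_mul_self (x : Plane) :
    ∫ z, q (x - z) * q (x - z) = ∫ w, q w ^ 2 := by
  simp_rw [← sq]
  exact integral_sub_left_eq_self (fun w => q w ^ 2) volume x

/-- The spatial covariance deficit is half of an `L²` modulus of continuity. -/
lemma integral_sq_sub_integral_mul (hq : CondWeakWith c δ q) (hc : 0 < c) (hδ : 0 < δ)
    (x y : Plane) :
    2 * ((∫ w, q w ^ 2) - ∫ z, q (x - z) * q (y - z)) = ∫ z, (q (x - z) - q (y - z)) ^ 2 := by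
  have hx := hq.memLp_two_comp_sub hc hδ x
  have hy := hq.memLp_two_comp_sub hc hδ y
  have hexp : ∀ z, (q (x - z) - q (y - z)) ^ 2 =
      q (x - z) ^ 2 + q (y - z) ^ 2 - 2 * (q (x - z) * q (y - z)) := fun z => by ring
  simp_rw [hexp]
  have hadd : Integrable fun z => q (x - z) ^ 2 + q (y - z) ^ 2 :=
    hx.integrable_sq.add hy.integrable_sq
  have hmul : Integrable fun z => q (x - z) * q (y - z) := MemLp.integrable_mul hx hy
  rw [integral_sub hadd (hmul.const_mul 2),
    integral_add hx.integrable_sq hy.integrable_sq, integral_const_mul,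
    integral_sub_left_eq_self (fun w => q w ^ 2) volume x,
    integral_sub_left_eq_self (fun w => q w ^ 2) volume y]
  ring

lemma integral_sub_sq_le (hq : CondWeakWith c δ q) (hc : 0 < c) (hδ : 0 < δ)
    {x y : Plane} (hxy : ‖x - y‖ ≤ 2) :
    ∫ z, (q (x - z) - q (y - z)) ^ 2 ≤ ‖x - y‖ ^ 2 * varianceBound c δ := by
  have hx := hq.memLp_two_comp_sub hc hδ x
  have hy := hq.memLp_two_comp_sub hc hδ y
  have hG : Integrable fun z => decayEnvelope c δ (x - z) ^ 2 :=
    (integrable_decayEnvelope_sq c hδ).comp_sub_left x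
  calc ∫ z, (q (x - z) - q (y - z)) ^ 2
      ≤ ∫ z, ‖x - y‖ ^ 2 * decayEnvelope c δ (x - z) ^ 2 := by
        refine integral_mono (hx.sub hy).integrable_sq (hG.const_mul _) fun z => ?_
        have h := hq.abs_sub_le hc hδ (u := x - z) (w := y - z) (by simpa using hxy)
        rw [sub_sub_sub_cancel_right] at h
        simp only
        rw [← mul_pow]
        exact sq_le_sq' (neg_le_of_abs_le h) (le_of_abs_le h)
    _ = ‖x - y‖ ^ 2 * ∫ w, decayEnvelope c δ w ^ 2 := by
        rw [integral_const_mul,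
          integral_sub_left_eq_self (fun w => decayEnvelope c δ w ^ 2) volume x]
    _ ≤ _ := by
        unfold varianceBound
        gcongr
        linarith

end CondWeakWith

/-- A two-sided Gaussian tail bound in terms of an upper bound on the variance. -/
lemma measure_le_abs_of_map_eq_gaussianReal {Ω : Type*} [MeasurableSpace Ω] {P : Measure Ω}
    [IsProbabilityMeasure P] {X : Ω → ℝ} {v : ℝ≥0}
    (hX : P.map X = ProbabilityTheory.gaussianReal 0 v) {σ : ℝ} (hσ : ∫ ω, X ω ^ 2 ∂P ≤ σ)
    {r : ℝ} (hr : 0 ≤ r) :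
    P {ω | r ≤ |X ω|} ≤ ENNReal.ofReal (2 * Real.exp (-r ^ 2 / (2 * σ))) := by
  have hXm : AEMeasurable X P := by
    by_contra h
    rw [Measure.map_of_not_aemeasurable h] at hX
    exact (NeZero.ne (ProbabilityTheory.gaussianReal 0 v)) hX.symm
  have hv : (v : ℝ) ≤ σ := by
    have h1 := ProbabilityTheory.variance_id_gaussianReal (μ := 0) (v := v)
    rw [ProbabilityTheory.variance_of_integral_eq_zero aemeasurable_id (by simp), ← hX,
      integral_map hXm (by fun_prop)] at h1
    simpa [← h1] using hσ
  lift σ to ℝ≥0 using v.2.trans hv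
  have hsub : ProbabilityTheory.HasSubgaussianMGF X σ P := by
    refine ⟨fun t => ?_, fun t => ?_⟩
    · have := ProbabilityTheory.integrable_exp_mul_gaussianReal (μ := 0) (v := v) t
      rw [← hX, integrable_map_measure (by fun_prop) hXm] at this
      exact this
    · rw [ProbabilityTheory.mgf_gaussianReal hX t]
      simp only [zero_mul, zero_add]
      gcongr
  have h1 := hsub.measure_ge_le hr
  have h2 := hsub.neg.measure_ge_le hr
  simp only [Pi.neg_apply] at h1 h2
  have hsplit : {ω | r ≤ |X ω|} = {ω | r ≤ X ω} ∪ {ω | r ≤ -X ω} := by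
    ext ω
    simp [le_abs]
  rw [hsplit, ← ofReal_measureReal]
  refine ENNReal.ofReal_le_ofReal ((measureReal_union_le _ _).trans ?_)
  linarith

namespace IsDynQField

variable {Ω : Type*} [MeasurableSpace Ω] {P : Measure Ω}
  {c δ : ℝ} {q : Plane → ℝ} {f : Ω → ℝ → Plane → ℝ}

lemma memLp_two_s7 (hf : IsDynQField P q f) {t : ℝ} (ht : 0 ≤ t) (x : Plane) :
    MemLp (fun ω => f ω t x) 2 P := by
  obtain ⟨v, hv⟩ := hf.gaussian 1 (fun _ => 1) (fun _ => t) (fun _ => x) fun _ => ht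
  simp only [one_mul, Finset.univ_unique, Finset.sum_const, Finset.card_singleton, one_smul] at hv
  have hm : Measurable fun ω => f ω t x :=
    hf.measurable.comp (measurable_id.prodMk (measurable_const (a := (t, x))))
  have := ProbabilityTheory.memLp_id_gaussianReal (μ := 0) (v := v) 2
  rw [← hv, memLp_map_measure_iff (by fun_prop) hm.aemeasurable] at this
  exact_mod_cast this

/-- The difference of the time increments `f(t,x) - f(0,x)` and `f(s,y) - f(0,y)`. -/
def rectIncr (f : Ω → ℝ → Plane → ℝ) (t : ℝ) (x : Plane) (s : ℝ) (y : Plane) (ω : Ω) : ℝ :=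
  (f ω t x - f ω 0 x) - (f ω s y - f ω 0 y)

lemma exists_map_rectIncr (hf : IsDynQField P q f) {t s : ℝ} (ht : 0 ≤ t) (hs : 0 ≤ s)
    (x y : Plane) :
    ∃ v : ℝ≥0, P.map (rectIncr f t x s y) = ProbabilityTheory.gaussianReal 0 v := by
  obtain ⟨v, hv⟩ := hf.gaussian 4 ![1, -1, -1, 1] ![t, 0, s, 0] ![x, x, y, y] (by
    intro i
    fin_cases i <;> simp [ht, hs])
  refine ⟨v, ?_⟩
  rw [← hv]
  congr 1
  ext ω
  simp only [rectIncr, Fin.sum_univ_four, Matrix.cons_val]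
  ring

lemma integral_rectIncr_sq (hf : IsDynQField P q f) (hq : CondWeakWith c δ q) (hc : 0 < c)
    (hδ : 0 < δ) {t s : ℝ} (ht : 0 ≤ t) (hs : 0 ≤ s) (x y : Plane) :
    ∫ ω, rectIncr f t x s y ω ^ 2 ∂P =
      2 * (1 - Real.exp (-|t - s|)) * (∫ w, q w ^ 2) +
      (1 + Real.exp (-|t - s|) - Real.exp (-t) - Real.exp (-s)) *
        ∫ z, (q (x - z) - q (y - z)) ^ 2 := by
  have hA := hf.memLp_two_s7 ht x
  have hB := hf.memLp_two_s7 le_rfl x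
  have hC := hf.memLp_two_s7 hs y
  have hD := hf.memLp_two_s7 le_rfl y
  have i1 := MemLp.integrable_mul hA hA
  have i2 := MemLp.integrable_mul hB hB
  have i3 := MemLp.integrable_mul hC hC
  have i4 := MemLp.integrable_mul hD hD
  have i5 := MemLp.integrable_mul hA hB
  have i6 := MemLp.integrable_mul hA hC
  have i7 := MemLp.integrable_mul hA hD
  have i8 := MemLp.integrable_mul hB hC
  have i9 := MemLp.integrable_mul hB hD
  have i10 := MemLp.integrable_mul hC hD
  simp only [Pi.mul_def] at i1 i2 i3 i4 i5 i6 i7 i8 i9 i10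
  have hexp : ∀ ω, rectIncr f t x s y ω ^ 2 =
      f ω t x * f ω t x + f ω 0 x * f ω 0 x + f ω s y * f ω s y + f ω 0 y * f ω 0 y
      - 2 * (f ω t x * f ω 0 x) - 2 * (f ω t x * f ω s y) + 2 * (f ω t x * f ω 0 y)
      + 2 * (f ω 0 x * f ω s y) - 2 * (f ω 0 x * f ω 0 y) - 2 * (f ω s y * f ω 0 y) := by
    intro ω
    unfold rectIncr
    ring
  simp_rw [hexp]
  rw [integral_sub (by fun_prop) (by fun_prop), integral_sub (by fun_prop) (by fun_prop),
    integral_add (by fun_prop) (by fun_prop), integral_add (by fun_prop) (by fun_prop),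
    integral_sub (by fun_prop) (by fun_prop), integral_sub (by fun_prop) (by fun_prop),
    integral_add (by fun_prop) (by fun_prop), integral_add (by fun_prop) (by fun_prop),
    integral_add (by fun_prop) (by fun_prop)]
  simp_rw [integral_const_mul]
  rw [hf.covariance t t ht ht, hf.covariance 0 0 le_rfl le_rfl, hf.covariance s s hs hs,
    hf.covariance 0 0 le_rfl le_rfl, hf.covariance 0 t le_rfl ht, hf.covariance s t hs ht,
    hf.covariance 0 t le_rfl ht, hf.covariance s 0 hs le_rfl, hf.covariance 0 0 le_rfl le_rfl,
    hf.covariance 0 s le_rfl hs, ← hq.integral_sq_sub_integral_mul hc hδ x y,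
    CondWeakWith.integral_mul_self, CondWeakWith.integral_mul_self]
  simp only [sub_self, abs_zero, neg_zero, Real.exp_zero, sub_zero, zero_sub, abs_neg,
    abs_of_nonneg ht, abs_of_nonneg hs]
  ring

lemma integral_rectIncr_sq_le (hf : IsDynQField P q f) (hq : CondWeakWith c δ q) (hc : 0 < c)
    (hδ : 0 < δ) {t s : ℝ} (ht : 0 ≤ t) (hs : 0 ≤ s) {x y : Plane} (hxy : ‖x - y‖ ≤ 2) :
    ∫ ω, rectIncr f t x s y ω ^ 2 ∂P ≤
      varianceBound c δ * (2 * |t - s| + (t + s) * ‖x - y‖ ^ 2) := by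
  rw [hf.integral_rectIncr_sq hq hc hδ ht hs]
  have h1 : 1 - Real.exp (-|t - s|) ≤ |t - s| := by linarith [Real.add_one_le_exp (-|t - s|)]
  have h2 : Real.exp (-|t - s|) ≤ 1 := Real.exp_le_one_iff.2 (by simp)
  have h3 : 1 + Real.exp (-|t - s|) - Real.exp (-t) - Real.exp (-s) ≤ t + s := by
    linarith [Real.add_one_le_exp (-t), Real.add_one_le_exp (-s)]
  have h4 : 0 ≤ ∫ z, (q (x - z) - q (y - z)) ^ 2 := integral_nonneg fun _ => sq_nonneg _
  have h5 : 0 ≤ ∫ w, q w ^ 2 := integral_nonneg fun _ => sq_nonneg _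
  calc _ ≤ 2 * |t - s| * varianceBound c δ + (t + s) * (‖x - y‖ ^ 2 * varianceBound c δ) := by
        gcongr
        · exact hq.integral_sq_le hc hδ
        · exact hq.integral_sub_sq_le hc hδ hxy
    _ = _ := by ring

end IsDynQField

/-- The `k`-th point of the dyadic grid of mesh `2 / 2 ^ n`. -/
def dyadicPt (n k : ℕ) : ℝ := k * (2 / 2 ^ n)

/-- The index of the grid point of mesh `2 / 2 ^ n` just below `y`. -/
def dyadicIdx (n : ℕ) (y : ℝ) : ℕ := ⌊2 ^ n * (y / 2)⌋₊

lemma dyadicPt_nonneg (n k : ℕ) : 0 ≤ dyadicPt n k := by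
  unfold dyadicPt
  positivity

lemma dyadicPt_le_two {n k : ℕ} (hk : k < 2 ^ n) : dyadicPt n k ≤ 2 := by
  have h : (k : ℝ) ≤ 2 ^ n := by exact_mod_cast hk.le
  unfold dyadicPt
  calc (k : ℝ) * (2 / 2 ^ n) ≤ 2 ^ n * (2 / 2 ^ n) := by gcongr
    _ = 2 := by field_simp

lemma abs_dyadicPt_succ_sub_le (n k : ℕ) :
    |dyadicPt (n + 1) k - dyadicPt n (k / 2)| ≤ (1 / 2) ^ n := by
  have hk : (k : ℝ) = 2 * (k / 2 : ℕ) + (k % 2 : ℕ) := by exact_mod_cast (Nat.div_add_mod k 2).symm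
  have hr : ((k % 2 : ℕ) : ℝ) ≤ 1 := by exact_mod_cast Nat.lt_succ_iff.1 (Nat.mod_lt k two_pos)
  have heq : dyadicPt (n + 1) k - dyadicPt n (k / 2) = (k % 2 : ℕ) * (1 / 2) ^ n := by
    unfold dyadicPt
    rw [hk, one_div, inv_pow]
    field_simp
    ring
  rw [heq, abs_of_nonneg (by positivity)]
  exact mul_le_of_le_one_left (by positivity) hr

lemma dyadicIdx_succ_div_two (n : ℕ) (y : ℝ) : dyadicIdx (n + 1) y / 2 = dyadicIdx n y := by
  unfold dyadicIdx
  rw [← Nat.floor_div_natCast]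
  congr 1
  push_cast
  ring

lemma dyadicIdx_lt {y : ℝ} (hy : y ∈ Icc (0 : ℝ) 1) (n : ℕ) : dyadicIdx n y < 2 ^ n := by
  unfold dyadicIdx
  have h2 : (0 : ℝ) < 2 ^ n := by positivity
  rw [Nat.floor_lt (by have := hy.1; positivity)]
  push_cast
  nlinarith [hy.2]

lemma dyadicIdx_zero {y : ℝ} (hy : y ∈ Icc (0 : ℝ) 1) : dyadicIdx 0 y = 0 := by
  simpa using dyadicIdx_lt hy 0

lemma tendsto_dyadicPt_dyadicIdx {y : ℝ} (hy : 0 ≤ y) :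
    Filter.Tendsto (fun n => dyadicPt n (dyadicIdx n y)) Filter.atTop (nhds y) := by
  have h := (tendsto_nat_floor_mul_div_atTop (R := ℝ) (a := y / 2) (by positivity)).comp
    (tendsto_pow_atTop_atTop_of_one_lt (one_lt_two (α := ℝ)))
  convert! h.mul_const 2 using 2
  · simp only [dyadicPt, dyadicIdx, Function.comp]
    rw [mul_comm (y / 2)]
    ring
  · ring

/-- Union bound over the links of a dyadic chain in dimension three. -/
lemma measure_iUnion_chain_le {Ω : Type*} [MeasurableSpace Ω] (P : Measure Ω) (v : ℝ)
    (E : ∀ n : ℕ, Fin (2 ^ (n + 1)) × Fin (2 ^ (n + 1)) × Fin (2 ^ (n + 1)) → Set Ω)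
    (hE : ∀ n i, P (E n i) ≤ ENNReal.ofReal (2 * Real.exp (-(3 * (n + 1) + v)))) :
    P (⋃ n, ⋃ i, E n i) ≤ ENNReal.ofReal (2 * Real.exp (-v)) := by
  have hexp : (16 : ℝ) ≤ Real.exp 3 := by
    have h1 := Real.exp_one_gt_d9
    have h2 : Real.exp 3 = Real.exp 1 ^ 3 := by rw [← Real.exp_nat_mul]; norm_num
    rw [h2]
    calc (16 : ℝ) ≤ 2.7 ^ 3 := by norm_num
      _ ≤ _ := by gcongr; linarith
  have hlevel : ∀ n : ℕ,
      P (⋃ i, E n i) ≤ ENNReal.ofReal ((1 / 2) ^ n * Real.exp (-v)) := by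
    intro n
    calc P (⋃ i, E n i) ≤ ∑ i, P (E n i) := measure_iUnion_fintype_le _ _
      _ ≤ ∑ _i : Fin (2 ^ (n + 1)) × Fin (2 ^ (n + 1)) × Fin (2 ^ (n + 1)),
          ENNReal.ofReal (2 * Real.exp (-(3 * (n + 1) + v))) :=
        Finset.sum_le_sum fun i _ => hE n i
      _ = ENNReal.ofReal (8 ^ (n + 1) * (2 * Real.exp (-(3 * (n + 1) + v)))) := by
        rw [Finset.sum_const, Finset.card_univ, Fintype.card_prod, Fintype.card_prod,
          Fintype.card_fin, ← ENNReal.ofReal_nsmul, nsmul_eq_mul]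
        congr 2
        push_cast
        rw [← mul_pow, ← mul_pow]
        norm_num
      _ ≤ _ := by
        apply ENNReal.ofReal_le_ofReal
        have h3 : Real.exp (-(3 * (n + 1) + v)) = (Real.exp 3 ^ (n + 1))⁻¹ * Real.exp (-v) := by
          rw [← Real.exp_nat_mul, ← Real.exp_neg, ← Real.exp_add]
          congr 1
          push_cast
          ring
        have h4 : (Real.exp 3 ^ (n + 1))⁻¹ ≤ ((16 : ℝ) ^ (n + 1))⁻¹ := by gcongr
        rw [h3]
        calc (8 : ℝ) ^ (n + 1) * (2 * ((Real.exp 3 ^ (n + 1))⁻¹ * Real.exp (-v)))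
            ≤ 8 ^ (n + 1) * (2 * (((16 : ℝ) ^ (n + 1))⁻¹ * Real.exp (-v))) := by gcongr
          _ = 2 * (8 / 16) ^ (n + 1) * Real.exp (-v) := by rw [div_pow]; ring
          _ = _ := by norm_num [pow_succ]; ring
  calc P (⋃ n, ⋃ i, E n i) ≤ ∑' n, P (⋃ i, E n i) := measure_iUnion_le _
    _ ≤ ∑' n : ℕ, ENNReal.ofReal ((1 / 2) ^ n * Real.exp (-v)) := ENNReal.tsum_le_tsum hlevel
    _ = _ := by
      rw [← ENNReal.ofReal_tsum_of_nonneg (fun n => by positivity)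
        (summable_geometric_two.mul_right _), tsum_mul_right, tsum_geometric_two]

/-- The shape of the thresholds used along the dyadic chain. -/
def chainWeight (n : ℕ) : ℝ := √(1 / 2) ^ n * (n + 1)

lemma chainWeight_pos (n : ℕ) : 0 < chainWeight n := by
  unfold chainWeight
  positivity

lemma summable_chainWeight : Summable chainWeight := by
  have hr : ‖√(1 / 2 : ℝ)‖ < 1 := by
    rw [Real.norm_of_nonneg (by positivity), Real.sqrt_lt' one_pos]
    norm_num
  have h1 := summable_pow_mul_geometric_of_norm_lt_one 1 hr
  have h0 := summable_geometric_of_norm_lt_one hr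
  refine (h1.add h0).congr fun n => ?_
  simp only [chainWeight, pow_one]
  ring

/-- The grid point of the plane with the given dyadic indices. -/
def dyadicPlanePt (n j k : ℕ) : Plane := !₂[dyadicPt n j, dyadicPt n k]

lemma norm_dyadicPlanePt_succ_sub_sq_le (n j k : ℕ) :
    ‖dyadicPlanePt (n + 1) j k - dyadicPlanePt n (j / 2) (k / 2)‖ ^ 2 ≤ 2 * (1 / 2) ^ n := by
  have hj := abs_dyadicPt_succ_sub_le n j
  have hk := abs_dyadicPt_succ_sub_le n k
  have hn : ((1 : ℝ) / 2) ^ n ≤ 1 := pow_le_one₀ (by norm_num) (by norm_num)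
  have hsq : ∀ d : ℝ, |d| ≤ (1 / 2) ^ n → d ^ 2 ≤ (1 / 2) ^ n := fun d hd => by
    rw [← sq_abs]
    nlinarith [abs_nonneg d]
  rw [EuclideanSpace.real_norm_sq_eq, Fin.sum_univ_two]
  change (dyadicPt (n + 1) j - dyadicPt n (j / 2)) ^ 2 +
    (dyadicPt (n + 1) k - dyadicPt n (k / 2)) ^ 2 ≤ _
  linarith [hsq _ hj, hsq _ hk]

namespace IsDynQField

variable {Ω : Type*} [MeasurableSpace Ω] {P : Measure Ω}
  {c δ : ℝ} {q : Plane → ℝ} {f : Ω → ℝ → Plane → ℝ}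

/-- The increment along the link joining a grid point of level `n + 1` to its parent, on the
time interval `[0, h]`. -/
def chainLink (f : Ω → ℝ → Plane → ℝ) (h : ℝ) (n i j k : ℕ) : Ω → ℝ :=
  rectIncr f (h * dyadicPt (n + 1) i) (dyadicPlanePt (n + 1) j k)
    (h * dyadicPt n (i / 2)) (dyadicPlanePt n (j / 2) (k / 2))

lemma integral_chainLink_sq_le (hf : IsDynQField P q f) (hq : CondWeakWith c δ q) (hc : 0 < c)
    (hδ : 0 < δ) {h : ℝ} (hh : 0 ≤ h) {n i : ℕ} (hi : i < 2 ^ (n + 1)) (j k : ℕ) :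
    ∫ ω, chainLink f h n i j k ω ^ 2 ∂P ≤ 10 * varianceBound c δ * h * (1 / 2) ^ n := by
  have hi' : i / 2 < 2 ^ n := by
    rw [pow_succ] at hi
    omega
  have hn : ((1 : ℝ) / 2) ^ n ≤ 1 := pow_le_one₀ (by norm_num) (by norm_num)
  have hsq := norm_dyadicPlanePt_succ_sub_sq_le n j k
  have hdist : ‖dyadicPlanePt (n + 1) j k - dyadicPlanePt n (j / 2) (k / 2)‖ ≤ 2 := by
    refine abs_le_of_sq_le_sq' ?_ (by norm_num) |>.2
    linarith
  have h1 := dyadicPt_nonneg (n + 1) i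
  have h2 := dyadicPt_nonneg n (i / 2)
  have h3 := dyadicPt_le_two hi
  have h4 := dyadicPt_le_two hi'
  have hV := varianceBound_pos c δ
  refine (hf.integral_rectIncr_sq_le hq hc hδ (by positivity) (by positivity) hdist).trans ?_
  rw [← mul_sub, abs_mul, abs_of_nonneg hh, ← mul_add]
  calc _ ≤ varianceBound c δ * (2 * (h * (1 / 2) ^ n) + h * (2 + 2) * (2 * (1 / 2) ^ n)) := by
        gcongr
        exact abs_dyadicPt_succ_sub_le n i
    _ = _ := by ring

lemma measure_chainLink_le [IsProbabilityMeasure P] (hf : IsDynQField P q f)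
    (hq : CondWeakWith c δ q) (hc : 0 < c)
    (hδ : 0 < δ) {h : ℝ} (hh : 0 < h) {v : ℝ} (hv : 1 ≤ v) {n i : ℕ} (hi : i < 2 ^ (n + 1))
    (j k : ℕ) :
    P {ω | √(80 * varianceBound c δ) * √(h * v) * chainWeight n ≤ |chainLink f h n i j k ω|} ≤
      ENNReal.ofReal (2 * Real.exp (-(3 * (n + 1) + v))) := by
  have hV := varianceBound_pos c δ
  have hw := chainWeight_pos n
  obtain ⟨σ, hσ⟩ := hf.exists_map_rectIncr (t := h * dyadicPt (n + 1) i)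
    (s := h * dyadicPt n (i / 2)) (mul_nonneg hh.le (dyadicPt_nonneg _ _))
    (mul_nonneg hh.le (dyadicPt_nonneg _ _)) (dyadicPlanePt (n + 1) j k)
    (dyadicPlanePt n (j / 2) (k / 2))
  refine (measure_le_abs_of_map_eq_gaussianReal hσ
    (hf.integral_chainLink_sq_le hq hc hδ hh.le hi j k) (by positivity)).trans ?_
  have hexponent : -(√(80 * varianceBound c δ) * √(h * v) * chainWeight n) ^ 2 /
      (2 * (10 * varianceBound c δ * h * (1 / 2) ^ n)) = -(4 * v * (n + 1) ^ 2) := by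
    have hsqrt : (√(1 / 2 : ℝ) ^ n) ^ 2 = (1 / 2) ^ n := by
      rw [← pow_mul, mul_comm, pow_mul, Real.sq_sqrt (by norm_num)]
    have hp : (0 : ℝ) < (1 / 2) ^ n := by positivity
    rw [chainWeight, mul_pow, mul_pow, mul_pow, hsqrt, Real.sq_sqrt (by positivity),
      Real.sq_sqrt (by positivity)]
    generalize ((1 : ℝ) / 2) ^ n = p at hp
    field_simp
    ring
  rw [hexponent]
  have hn : (0 : ℝ) ≤ n := n.cast_nonneg
  gcongr
  nlinarith [mul_nonneg hn hn, mul_nonneg (sub_nonneg.2 hv) hn,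
    mul_nonneg (sub_nonneg.2 hv) (mul_nonneg hn hn)]

end IsDynQField

/-- On a continuous sample path, small chain links give small increments. -/
lemma abs_sub_le_of_chainLink_lt {Ω : Type*} {f : Ω → ℝ → Plane → ℝ} {ω : Ω}
    (hcont : ContinuousOn (fun p : ℝ × Plane => f ω p.1 p.2) (Ici 0 ×ˢ univ))
    {h A : ℝ} (hh : 0 < h)
    (hlink : ∀ n i j k, i < 2 ^ (n + 1) → j < 2 ^ (n + 1) → k < 2 ^ (n + 1) →
      |IsDynQField.chainLink f h n i j k ω| < A * chainWeight n)
    {t : ℝ} (ht : t ∈ Icc 0 h) {x : Plane} (hx0 : x 0 ∈ Icc (0 : ℝ) 1)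
    (hx1 : x 1 ∈ Icc (0 : ℝ) 1) :
    |f ω t x - f ω 0 x| ≤ A * ∑' n, chainWeight n := by
  have hτ : t / h ∈ Icc (0 : ℝ) 1 := ⟨div_nonneg ht.1 hh.le, (div_le_one hh).2 ht.2⟩
  set T : ℕ → ℝ := fun n => h * dyadicPt n (dyadicIdx n (t / h)) with hT
  set X : ℕ → Plane := fun n => dyadicPlanePt n (dyadicIdx n (x 0)) (dyadicIdx n (x 1)) with hX
  set F : ℕ → ℝ := fun n => f ω (T n) (X n) - f ω 0 (X n) with hF
  have hT0 : ∀ n, 0 ≤ T n := fun n => mul_nonneg hh.le (dyadicPt_nonneg _ _)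
  have hTlim : Filter.Tendsto T Filter.atTop (nhds t) := by
    have := (tendsto_dyadicPt_dyadicIdx hτ.1).const_mul h
    rwa [mul_div_cancel₀ _ hh.ne'] at this
  have hXlim : Filter.Tendsto X Filter.atTop (nhds x) := by
    have hpi : Filter.Tendsto (fun n => ![dyadicPt n (dyadicIdx n (x 0)),
        dyadicPt n (dyadicIdx n (x 1))]) Filter.atTop (nhds (WithLp.ofLp x)) := by
      rw [tendsto_pi_nhds]
      intro i
      fin_cases i
      · exact tendsto_dyadicPt_dyadicIdx hx0.1
      · exact tendsto_dyadicPt_dyadicIdx hx1.1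
    exact ((PiLp.continuous_toLp 2 (fun _ : Fin 2 => ℝ)).tendsto _).comp hpi
  have hlim : ∀ {S : ℕ → ℝ} {s : ℝ}, (∀ n, 0 ≤ S n) → 0 ≤ s →
      Filter.Tendsto S Filter.atTop (nhds s) →
      Filter.Tendsto (fun n => f ω (S n) (X n)) Filter.atTop (nhds (f ω s x)) := by
    intro S s hS hs hSlim
    refine (hcont (s, x) ⟨hs, mem_univ _⟩).tendsto.comp
      (tendsto_nhdsWithin_iff.2 ⟨hSlim.prodMk_nhds hXlim, .of_forall fun n => ⟨hS n, mem_univ _⟩⟩)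
  have hFlim : Filter.Tendsto F Filter.atTop (nhds (f ω t x - f ω 0 x)) :=
    (hlim hT0 ht.1 hTlim).sub (hlim (fun _ => le_rfl) le_rfl tendsto_const_nhds)
  have hF0 : F 0 = 0 := by
    simp [hF, hT, dyadicIdx_zero hτ, dyadicPt]
  have hstep : ∀ n, dist (F n) (F (n + 1)) ≤ A * chainWeight n := by
    intro n
    have := (hlink n _ _ _ (dyadicIdx_lt hτ (n + 1)) (dyadicIdx_lt hx0 (n + 1))
      (dyadicIdx_lt hx1 (n + 1))).le
    rw [IsDynQField.chainLink, dyadicIdx_succ_div_two, dyadicIdx_succ_div_two,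
      dyadicIdx_succ_div_two] at this
    rw [dist_comm, Real.dist_eq]
    exact this
  have := dist_le_tsum_of_dist_le_of_tendsto₀ _ hstep (summable_chainWeight.mul_left A) hFlim
  rwa [hF0, dist_comm, Real.dist_eq, sub_zero, tsum_mul_left] at this

/-- **A short-time supremum estimate for a dynamical planar Gaussian field.** If `q`
satisfies Condition (Weak) with constants `c, δ`, then for every `a ∈ (0,1)` there are
constants `C, C', κ > 0` depending only on `a, c, δ` such that for every `h ∈ [0,1]`,
`P[ sup_{t ∈ [0,h], x ∈ [0,1]²} |f(t,x) - f(0,x)| ≥ C h^{(1-a)/2} ] ≤ C' exp(-κ h^{-a})`. -/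
theorem short_time_sup_estimate
    (c δ : ℝ) (hc : 0 < c) (hδ : 0 < δ) (a : ℝ) (ha : a ∈ Set.Ioo (0 : ℝ) 1) :
    ∃ C > (0 : ℝ), ∃ C' > (0 : ℝ), ∃ κ > (0 : ℝ),
      ∀ {Ω : Type} [MeasurableSpace Ω] (P : Measure Ω), IsProbabilityMeasure P →
      ∀ (q : Plane → ℝ) (f : Ω → ℝ → Plane → ℝ),
        CondWeakWith c δ q → IsDynQField P q f →
        ∀ h ∈ Set.Icc (0 : ℝ) 1,
          P {ω | ∃ t ∈ Set.Icc (0 : ℝ) h, ∃ x : Plane,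
              x 0 ∈ Set.Icc (0 : ℝ) 1 ∧ x 1 ∈ Set.Icc (0 : ℝ) 1 ∧
              C * h ^ ((1 - a) / 2) ≤ |f ω t x - f ω 0 x|}
            ≤ ENNReal.ofReal (C' * Real.exp (-κ * h ^ (-a))) := by
  have hV := varianceBound_pos c δ
  have hS : 0 ≤ ∑' n, chainWeight n := tsum_nonneg fun n => (chainWeight_pos n).le
  refine ⟨√(80 * varianceBound c δ) * (∑' n, chainWeight n) + 1, by positivity, 2, two_pos,
    1, one_pos, ?_⟩
  intro Ω _ P hP q f hq hf h hh
  rcases hh.1.eq_or_lt with rfl | hpos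
  · refine prob_le_one.trans ?_
    rw [Real.zero_rpow (neg_ne_zero.2 ha.1.ne'), mul_zero, Real.exp_zero, mul_one]
    norm_num
  have hv : 1 ≤ h ^ (-a) :=
    Real.one_le_rpow_of_pos_of_le_one_of_nonpos hpos hh.2 (by linarith [ha.1])
  have hscale : √(h * h ^ (-a)) = h ^ ((1 - a) / 2) := by
    rw [← Real.rpow_one_add' hh.1 (by linarith [ha.2]), Real.sqrt_eq_rpow,
      ← Real.rpow_mul hh.1]
    congr 1
    ring
  have hscale_pos : 0 < h ^ ((1 - a) / 2) := Real.rpow_pos_of_pos hpos _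
  rw [neg_one_mul]
  refine le_trans ?_ (measure_iUnion_chain_le P (h ^ (-a))
    (fun n i => {ω | √(80 * varianceBound c δ) * √(h * h ^ (-a)) * chainWeight n ≤
      |IsDynQField.chainLink f h n i.1 i.2.1 i.2.2 ω|})
    fun n i => hf.measure_chainLink_le hq hc hδ hpos hv i.1.2 i.2.1 i.2.2)
  refine measure_mono_ae ?_
  filter_upwards [hf.continuous] with ω hcont
  rintro ⟨t, ht, x, hx0, hx1, hle⟩
  by_contra hgood
  change ω ∉ ⋃ n, ⋃ i, _ at hgood
  simp only [mem_iUnion, mem_ofPred_eq, not_exists, not_le] at hgood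
  have := abs_sub_le_of_chainLink_lt hcont hpos
    (fun n i j k hi hj hk => hgood n (⟨i, hi⟩, ⟨j, hj⟩, ⟨k, hk⟩)) ht hx0 hx1
  rw [hscale] at this
  nlinarith

end
end

section
/- Let q : ℝ² → ℝ satisfy Condition (Weak), and let f : Ω × ℝ≥0 × ℝ² → ℝ be a jointly measurable map on a probability space such that {f(t,x)} is a centered Gaussian family with covariance E[f(t,x) f(s,y)] = e^{−|t−s|} ∫_{ℝ²} q(x−z) q(y−z) dz. Then there exists a modification f̃ of f (i.e., for every (t,x), f̃(t,x) = f(t,x) almost surely) such that almost surely the map (t,x) ↦ f̃(t,x) is continuous on ℝ≥0 × ℝ². -/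
open MeasureTheory Set
open scoped ENNReal NNReal

noncomputable section

open ProbabilityTheory Filter Topology Metric

/-- A continuous averaging kernel: a probability density supported in the ball of radius `r`
around the origin and bounded by `K`. -/
structure IsAveragingKernel {E : Type*} [NormedAddCommGroup E] [MeasurableSpace E]
    (μ : Measure E) (k : E → ℝ) (r : ℝ) (K : ℝ≥0∞) : Prop where
  continuous : Continuous k
  hasCompactSupport : HasCompactSupport k
  nonneg : ∀ x, 0 ≤ k x
  integral_eq_one : ∫ x, k x ∂μ = 1
  eq_zero : ∀ x, r ≤ ‖x‖ → k x = 0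
  enorm_le : ∀ x, ‖k x‖ₑ ≤ K

theorem exists_isAveragingKernel {E : Type*} [NormedAddCommGroup E] [NormedSpace ℝ E]
    [FiniteDimensional ℝ E] [MeasurableSpace E] [BorelSpace E] (μ : Measure E)
    [μ.IsAddHaarMeasure] :
    ∃ C : ℝ≥0∞, C ≠ ∞ ∧ ∀ r : ℝ, 0 < r →
      ∃ k, IsAveragingKernel μ k r (C * (ENNReal.ofReal r)⁻¹ ^ Module.finrank ℝ E) := by
  set d := Module.finrank ℝ E
  have hb : 0 < μ (ball (0 : E) 1) := measure_ball_pos _ _ one_pos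
  have hb' : μ (ball (0 : E) 1) ≠ ∞ := measure_ball_lt_top.ne
  refine ⟨ENNReal.ofReal (2 ^ d) * (μ (ball (0 : E) 1))⁻¹,
    ENNReal.mul_ne_top ENNReal.ofReal_ne_top (ENNReal.inv_ne_top.2 hb.ne'), fun r hr => ?_⟩
  let φ : ContDiffBump (0 : E) := ⟨r / 2, r, by positivity, by linarith⟩
  refine ⟨φ.normed μ, φ.continuous_normed, φ.hasCompactSupport_normed, φ.nonneg_normed,
    φ.integral_normed, fun x hx => ?_, fun x => ?_⟩
  · have : x ∉ Function.support (φ.normed μ) := by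
      rw [φ.support_normed_eq]
      simpa using hx
    simpa using this
  · have h1 : φ.normed μ x ≤ 2 ^ d / μ.real (closedBall (0 : E) r) :=
      φ.normed_le_div_measure_closedBall_rOut (μ := μ) 2 (by change r ≤ 2 * (r / 2); linarith) x
    have h2 : 0 < μ.real (closedBall (0 : E) r) :=
      ENNReal.toReal_pos (measure_closedBall_pos _ _ hr).ne' measure_closedBall_lt_top.ne
    rw [Real.enorm_of_nonneg (φ.nonneg_normed x)]
    refine (ENNReal.ofReal_le_ofReal h1).trans_eq ?_
    rw [ENNReal.ofReal_div_of_pos h2, ofReal_measureReal measure_closedBall_lt_top.ne,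
      Measure.addHaar_closedBall μ 0 hr.le, div_eq_mul_inv,
      ENNReal.mul_inv (Or.inr hb') (Or.inr hb.ne'), ENNReal.ofReal_pow hr.le, ENNReal.inv_pow]
    ring

section Kernel

variable {E : Type*} [NormedAddCommGroup E] [MeasurableSpace E] [BorelSpace E] {μ : Measure E}
variable {k : E → ℝ} {r : ℝ} {K : ℝ≥0∞} {h : E → ℝ}

theorem IsAveragingKernel.continuous_integral (hk : IsAveragingKernel μ k r K)
    (hh : LocallyIntegrable h μ) : Continuous fun x => ∫ u, h u * k (x - u) ∂μ :=
  hk.hasCompactSupport.continuous_convolution_right (ContinuousLinearMap.mul ℝ ℝ) hh hk.continuous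

theorem IsAveragingKernel.lintegral_mul_le (hk : IsAveragingKernel μ k r K) (x : E)
    (F : E → ℝ≥0∞) (hK : K ≠ ∞) :
    ∫⁻ u, ‖k (x - u)‖ₑ * F u ∂μ ≤ K * ∫⁻ u in ball x r, F u ∂μ := by
  rw [← lintegral_const_mul' _ _ hK, ← lintegral_indicator measurableSet_ball]
  refine lintegral_mono fun u => ?_
  by_cases hu : u ∈ ball x r
  · rw [indicator_of_mem hu]
    gcongr
    exact hk.enorm_le _
  · rw [hk.eq_zero (x - u) (by simpa [dist_eq_norm_sub'] using hu)]
    simp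

variable [NormedSpace ℝ E] [FiniteDimensional ℝ E] [μ.IsAddHaarMeasure]

theorem IsAveragingKernel.lintegral_enorm_eq_one (hk : IsAveragingKernel μ k r K) (x : E) :
    ∫⁻ u, ‖k (x - u)‖ₑ ∂μ = 1 := by
  rw [lintegral_sub_left_eq_self (fun u => ‖k u‖ₑ) x]
  have hi : Integrable k μ := hk.continuous.integrable_of_hasCompactSupport hk.hasCompactSupport
  have := ofReal_integral_eq_lintegral_ofReal hi (ae_of_all _ hk.nonneg)
  rw [hk.integral_eq_one, ENNReal.ofReal_one] at this
  rw [this]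
  exact lintegral_congr fun u => Real.enorm_of_nonneg (hk.nonneg u)

theorem IsAveragingKernel.enorm_integral_sub_le (hk : IsAveragingKernel μ k r K)
    (hh : LocallyIntegrable h μ) (x : E) (c : ℝ) :
    ‖∫ u, h u * k (x - u) ∂μ - c‖ₑ ≤ ∫⁻ u, ‖k (x - u)‖ₑ * ‖h u - c‖ₑ ∂μ := by
  have hkx : Continuous fun u => k (x - u) := by have := hk.continuous; fun_prop
  have hkc : HasCompactSupport fun u => k (x - u) :=
    hk.hasCompactSupport.comp_homeomorph (Homeomorph.subLeft x)
  have h1 : Integrable (fun u => k (x - u) * h u) μ := by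
    simpa using hh.integrable_smul_left_of_hasCompactSupport hkx hkc
  have h2 : Integrable (fun u => k (x - u) * c) μ :=
    (hkx.integrable_of_hasCompactSupport hkc).mul_const c
  have h3 : ∫ u, k (x - u) * c ∂μ = c := by
    rw [integral_mul_const, integral_sub_left_eq_self k μ x, hk.integral_eq_one, one_mul]
  have h4 : ∫ u, h u * k (x - u) ∂μ - c = ∫ u, k (x - u) * (h u - c) ∂μ := by
    simp_rw [mul_sub, mul_comm (h _)]
    rw [integral_sub h1 h2, h3]
  rw [h4]
  refine (enorm_integral_le_lintegral_enorm _).trans_eq ?_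
  simp_rw [enorm_mul]

/-- Truncation of a power: `a ≤ ε + ε⁻ᵏ aᵏ⁺¹`. -/
theorem le_add_inv_pow_mul_pow (a : ℝ≥0∞) {ε : ℝ≥0∞} (h0 : ε ≠ 0) (k : ℕ) :
    a ≤ ε + ε⁻¹ ^ k * a ^ (k + 1) := by
  by_cases ht : ε = ∞
  · simp [ht]
  rcases le_total a ε with h | h
  · exact h.trans le_self_add
  · refine le_trans ?_ le_add_self
    have h1 : 1 ≤ ε⁻¹ * a := by
      rw [← ENNReal.inv_mul_cancel h0 ht]
      gcongr
    calc a = 1 ^ k * a := by simp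
      _ ≤ (ε⁻¹ * a) ^ k * a := by gcongr
      _ = _ := by ring

theorem IsAveragingKernel.lintegral_enorm_le (hk : IsAveragingKernel μ k r K)
    (hh : Measurable h) (hK : K ≠ ∞) (x : E) (c : ℝ) {ε : ℝ≥0∞} (h0 : ε ≠ 0) (n : ℕ) :
    ∫⁻ u, ‖k (x - u)‖ₑ * ‖h u - c‖ₑ ∂μ
      ≤ ε + ε⁻¹ ^ n * (K * ∫⁻ u in ball x r, ‖h u - c‖ₑ ^ (n + 1) ∂μ) := by
  have hkm : Measurable k := hk.continuous.measurable
  calc ∫⁻ u, ‖k (x - u)‖ₑ * ‖h u - c‖ₑ ∂μ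
      ≤ ∫⁻ u, (‖k (x - u)‖ₑ * ε + ε⁻¹ ^ n * (‖k (x - u)‖ₑ * ‖h u - c‖ₑ ^ (n + 1))) ∂μ := by
        refine lintegral_mono fun u => ?_
        refine (mul_le_mul_right (le_add_inv_pow_mul_pow ‖h u - c‖ₑ h0 n) _).trans_eq ?_
        ring
    _ = ε + ε⁻¹ ^ n * ∫⁻ u, ‖k (x - u)‖ₑ * ‖h u - c‖ₑ ^ (n + 1) ∂μ := by
        rw [lintegral_add_left (by fun_prop), lintegral_mul_const _ (by fun_prop),
          lintegral_const_mul _ (by fun_prop), hk.lintegral_enorm_eq_one, one_mul]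
    _ ≤ _ := by
        gcongr
        exact hk.lintegral_mul_le x _ hK

/-- Comparison of two local averages of the same function. -/
theorem IsAveragingKernel.enorm_integral_sub_integral_le {k' : E → ℝ} {r' : ℝ} {K' : ℝ≥0∞}
    (hk : IsAveragingKernel μ k r K) (hk' : IsAveragingKernel μ k' r' K')
    (hK : K ≠ ∞) (hK' : K' ≠ ∞) (hr : r' ≤ r) (hh : Measurable h) (hi : LocallyIntegrable h μ)
    {R : ℝ} {x : E} (hx : ‖x‖ + r ≤ R) {ε : ℝ≥0∞} (h0 : ε ≠ 0) (n : ℕ) :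
    ‖∫ u, h u * k (x - u) ∂μ - ∫ u, h u * k' (x - u) ∂μ‖ₑ
      ≤ ε + ε⁻¹ ^ n * (K * (K' * ∫⁻ u in ball 0 R, ∫⁻ v in ball u (2 * r),
          ‖h v - h u‖ₑ ^ (n + 1) ∂μ ∂μ)) := by
  have hkm : Measurable k := hk.continuous.measurable
  have he : ε⁻¹ ^ n ≠ ∞ := ENNReal.pow_ne_top (ENNReal.inv_ne_top.2 h0)
  calc ‖∫ u, h u * k (x - u) ∂μ - ∫ u, h u * k' (x - u) ∂μ‖ₑ
      ≤ ∫⁻ u, ‖k (x - u)‖ₑ * ‖h u - ∫ v, h v * k' (x - v) ∂μ‖ₑ ∂μ :=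
        hk.enorm_integral_sub_le hi x _
    _ ≤ ∫⁻ u, (‖k (x - u)‖ₑ * ε + ε⁻¹ ^ n * (‖k (x - u)‖ₑ * (K' * ∫⁻ v in ball x r',
          ‖h v - h u‖ₑ ^ (n + 1) ∂μ))) ∂μ := by
        refine lintegral_mono fun u => ?_
        rw [enorm_sub_rev]
        refine (mul_le_mul_right ((hk'.enorm_integral_sub_le hi x (h u)).trans
          (hk'.lintegral_enorm_le hh hK' x (h u) h0 n)) _).trans_eq ?_
        ring
    _ = ε + ε⁻¹ ^ n * ∫⁻ u, ‖k (x - u)‖ₑ * (K' * ∫⁻ v in ball x r',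
          ‖h v - h u‖ₑ ^ (n + 1) ∂μ) ∂μ := by
        rw [lintegral_add_left (by fun_prop), lintegral_mul_const _ (by fun_prop),
          lintegral_const_mul' _ _ he, hk.lintegral_enorm_eq_one, one_mul]
    _ ≤ ε + ε⁻¹ ^ n * (K * ∫⁻ u in ball x r, K' * ∫⁻ v in ball x r',
          ‖h v - h u‖ₑ ^ (n + 1) ∂μ ∂μ) := by
        gcongr
        exact hk.lintegral_mul_le x _ hK
    _ ≤ _ := by
        rw [lintegral_const_mul' _ _ hK']
        gcongr ε + ε⁻¹ ^ n * (K * (K' * ?_))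
        calc ∫⁻ u in ball x r, ∫⁻ v in ball x r', ‖h v - h u‖ₑ ^ (n + 1) ∂μ ∂μ
            ≤ ∫⁻ u in ball x r, ∫⁻ v in ball u (2 * r), ‖h v - h u‖ₑ ^ (n + 1) ∂μ ∂μ := by
              refine setLIntegral_mono' measurableSet_ball fun u hu => ?_
              refine lintegral_mono_set fun v hv => ?_
              rw [mem_ball] at *
              linarith [dist_triangle_right v u x]
          _ ≤ _ := by
              refine lintegral_mono_set fun u hu => ?_
              rw [mem_ball] at *
              rw [dist_zero_right]
              have := norm_le_norm_add_norm_sub' u x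
              rw [dist_eq_norm] at hu
              linarith

end Kernel

section Kolmogorov

variable {E : Type*} [NormedAddCommGroup E] [NormedSpace ℝ E] [FiniteDimensional ℝ E]
  [MeasurableSpace E] [BorelSpace E] {μ : Measure E} [μ.IsAddHaarMeasure]
  {Ω : Type*} [MeasurableSpace Ω] {P : Measure Ω} [IsProbabilityMeasure P]
  {X : Ω → E → ℝ} {M : ℝ≥0} {k m : ℕ}

theorem ae_locallyIntegrable_of_moment (hX : Measurable (Function.uncurry X))
    (hM : ∀ u v, ∫⁻ ω, ‖X ω u - X ω v‖ₑ ^ (k + 1) ∂P ≤ M * ‖u - v‖ₑ ^ m) :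
    ∀ᵐ ω ∂P, LocallyIntegrable (X ω) μ := by
  have hXu : ∀ u, Measurable fun ω => X ω u := fun u => hX.comp measurable_prodMk_right
  have hXω : ∀ ω, Measurable (X ω) := fun ω => hX.comp measurable_prodMk_left
  have hX2 : Measurable fun p : Ω × E => ‖X p.1 p.2 - X p.1 0‖ₑ :=
    (hX.sub ((hXu 0).comp measurable_fst)).enorm
  have h1 : ∀ R : ℕ, ∀ᵐ ω ∂P, ∫⁻ u in ball 0 (R : ℝ), ‖X ω u - X ω 0‖ₑ ∂μ < ∞ := by
    intro R
    refine ae_lt_top hX2.lintegral_prod_right' ?_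
    rw [lintegral_lintegral_swap hX2.aemeasurable]
    have h2 : ∀ u ∈ ball (0 : E) R, ∫⁻ ω, ‖X ω u - X ω 0‖ₑ ∂P ≤ 1 + M * ENNReal.ofReal R ^ m := by
      intro u hu
      calc ∫⁻ ω, ‖X ω u - X ω 0‖ₑ ∂P
          ≤ ∫⁻ ω, (1 + ‖X ω u - X ω 0‖ₑ ^ (k + 1)) ∂P := by
            refine lintegral_mono fun ω => ?_
            simpa using le_add_inv_pow_mul_pow ‖X ω u - X ω 0‖ₑ one_ne_zero k
        _ = 1 + ∫⁻ ω, ‖X ω u - X ω 0‖ₑ ^ (k + 1) ∂P := by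
            rw [lintegral_add_left measurable_const]; simp
        _ ≤ 1 + M * ‖u - 0‖ₑ ^ m := by gcongr; exact hM u 0
        _ ≤ _ := by
            gcongr
            rw [sub_zero, ← ofReal_norm]
            exact ENNReal.ofReal_le_ofReal (by simpa using (mem_ball.1 hu).le)
    refine ((setLIntegral_mono' measurableSet_ball h2).trans_lt ?_).ne
    rw [setLIntegral_const]
    refine ENNReal.mul_lt_top (ENNReal.add_lt_top.2 ⟨ENNReal.one_lt_top, ?_⟩) measure_ball_lt_top
    exact ENNReal.mul_lt_top ENNReal.coe_lt_top (ENNReal.pow_lt_top ENNReal.ofReal_lt_top)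
  filter_upwards [ae_all_iff.2 h1] with ω hω
  rw [locallyIntegrable_iff]
  intro K hK
  obtain ⟨R, hR⟩ := hK.isBounded.subset_ball (0 : E)
  obtain ⟨N, hN⟩ := exists_nat_ge R
  have hi : IntegrableOn (fun u => X ω u - X ω 0) (ball 0 (N : ℝ)) μ :=
    ⟨((hXω ω).sub measurable_const).aestronglyMeasurable, hω N⟩
  have hc : IntegrableOn (fun _ : E => X ω 0) (ball 0 (N : ℝ)) μ :=
    integrableOn_const measure_ball_lt_top.ne
  have := hi.add hc
  simp only [Pi.add_def, sub_add_cancel] at this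
  exact this.mono_set (hR.trans (ball_subset_ball hN))

theorem lintegral_oscillation_le (hX : Measurable (Function.uncurry X))
    (hM : ∀ u v, ∫⁻ ω, ‖X ω u - X ω v‖ₑ ^ (k + 1) ∂P ≤ M * ‖u - v‖ₑ ^ m) (R : ℝ) {r : ℝ}
    (hr : 0 < r) :
    Measurable (fun ω => ∫⁻ u in ball 0 R, ∫⁻ v in ball u r, ‖X ω v - X ω u‖ₑ ^ (k + 1) ∂μ ∂μ) ∧
    ∫⁻ ω, ∫⁻ u in ball 0 R, ∫⁻ v in ball u r, ‖X ω v - X ω u‖ₑ ^ (k + 1) ∂μ ∂μ ∂P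
      ≤ μ (ball 0 R) * (μ (ball 0 1) * M
        * ENNReal.ofReal r ^ (Module.finrank ℝ E + m)) := by
  have hX3 : Measurable fun p : (Ω × E) × E => ‖X p.1.1 p.2 - X p.1.1 p.1.2‖ₑ ^ (k + 1) :=
    (((hX.comp (by fun_prop : Measurable fun p : (Ω × E) × E => (p.1.1, p.2))).sub
      (hX.comp measurable_fst)).enorm.pow_const _)
  have hS : MeasurableSet {p : (Ω × E) × E | p.2 ∈ ball p.1.2 r} :=
    measurableSet_lt (measurable_snd.dist (measurable_snd.comp measurable_fst)) measurable_const
  have hX2 : Measurable fun p : Ω × E =>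
      ∫⁻ v in ball p.2 r, ‖X p.1 v - X p.1 p.2‖ₑ ^ (k + 1) ∂μ := by
    simp_rw [← lintegral_indicator (measurableSet_ball (x := _) (ε := r))]
    exact (hX3.indicator hS).lintegral_prod_right' (ν := μ)
  refine ⟨hX2.lintegral_prod_right', ?_⟩
  rw [lintegral_lintegral_swap hX2.aemeasurable]
  have h1 : ∀ u, ∫⁻ ω, ∫⁻ v in ball u r, ‖X ω v - X ω u‖ₑ ^ (k + 1) ∂μ ∂P
      ≤ μ (ball 0 1) * M * ENNReal.ofReal r ^ (Module.finrank ℝ E + m) := by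
    intro u
    have hX4 : Measurable fun p : Ω × E => ‖X p.1 p.2 - X p.1 u‖ₑ ^ (k + 1) :=
      hX3.comp (f := fun p : Ω × E => ((p.1, u), p.2)) (by fun_prop)
    rw [lintegral_lintegral_swap hX4.aemeasurable]
    calc ∫⁻ v in ball u r, ∫⁻ ω, ‖X ω v - X ω u‖ₑ ^ (k + 1) ∂P ∂μ
        ≤ ∫⁻ v in ball u r, M * ENNReal.ofReal r ^ m ∂μ := by
          refine setLIntegral_mono' measurableSet_ball fun v hv => (hM v u).trans ?_
          gcongr
          rw [← ofReal_norm, ← dist_eq_norm]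
          exact ENNReal.ofReal_le_ofReal (mem_ball.1 hv).le
      _ = _ := by
          have := Measure.addHaar_ball_mul_of_pos μ u hr 1
          rw [mul_one] at this
          rw [setLIntegral_const, this, ENNReal.ofReal_pow hr.le]
          ring
  refine (lintegral_mono fun u => h1 u).trans_eq ?_
  rw [setLIntegral_const, mul_comm]

theorem ofReal_half_pow (n k : ℕ) :
    ENNReal.ofReal (((1 / 2 : ℝ) ^ n) ^ k) = ((2 : ℝ≥0∞)⁻¹ ^ n) ^ k := by
  rw [ENNReal.ofReal_pow (by positivity), ENNReal.ofReal_pow (by positivity), one_div,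
    ENNReal.ofReal_inv_of_pos two_pos, ENNReal.ofReal_ofNat]

/-- **Kolmogorov–Chentsov continuity criterion** for a jointly measurable process indexed by a
finite-dimensional normed space. -/
theorem exists_continuous_modification_of_moment (hX : Measurable (Function.uncurry X))
    (hm : Module.finrank ℝ E < m)
    (hM : ∀ u v, ∫⁻ ω, ‖X ω u - X ω v‖ₑ ^ (k + 1) ∂P ≤ M * ‖u - v‖ₑ ^ m) :
    ∃ g : Ω → E → ℝ, (∀ u, ∀ᵐ ω ∂P, g ω u = X ω u) ∧ ∀ᵐ ω ∂P, Continuous (g ω) := by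
  have hXu : ∀ u, Measurable fun ω => X ω u := fun u => hX.comp measurable_prodMk_right
  have hXω : ∀ ω, Measurable (X ω) := fun ω => hX.comp measurable_prodMk_left
  obtain ⟨j, rfl⟩ := Nat.exists_eq_add_of_lt hm
  set d := Module.finrank ℝ E
  let μ : Measure E := Measure.addHaar
  obtain ⟨C, hC, hker⟩ := exists_isAveragingKernel μ
  let r : ℕ → ℝ := fun n => ((1 / 2 : ℝ) ^ n) ^ (k + 1)
  let ε : ℕ → ℝ≥0∞ := fun n => (2⁻¹ : ℝ≥0∞) ^ n
  let K : ℕ → ℝ≥0∞ := fun n => C * (ENNReal.ofReal (r n))⁻¹ ^ d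
  have hr : ∀ n, 0 < r n := fun n => by positivity
  have hr1 : ∀ n, r n ≤ 1 := fun n =>
    pow_le_one₀ (by positivity) (pow_le_one₀ (by norm_num) (by norm_num))
  have hrε : ∀ n, ENNReal.ofReal (r n) = ε n ^ (k + 1) := fun n => ofReal_half_pow n (k + 1)
  have hε0 : ∀ n, ε n ≠ 0 := fun n => pow_ne_zero _ (by simp)
  have hεt : ∀ n, ε n ≠ ∞ := fun n => ENNReal.pow_ne_top (by simp)
  have hε1 : ∀ n, ε n ≤ 1 := fun n => pow_le_one₀ (by simp) (by simp)
  have hεsum : ∑' n, ε n ≠ ∞ := by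
    rw [ENNReal.tsum_geometric]; simp
  have hK : ∀ n, K n ≠ ∞ := fun n => ENNReal.mul_ne_top hC
    (ENNReal.pow_ne_top (ENNReal.inv_ne_top.2 (by simpa using hr n)))
  choose κ hκ using fun n => hker (r n) (hr n)
  let A : ℕ → Ω → E → ℝ := fun n ω x => ∫ u, X ω u * κ n (x - u) ∂μ
  let S : ℕ → ℕ → Ω → ℝ≥0∞ := fun R n ω => ∫⁻ u in ball 0 (R : ℝ), ∫⁻ v in ball u (2 * r n),
    ‖X ω v - X ω u‖ₑ ^ (k + 1) ∂μ ∂μ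
  let b : ℕ → ℕ → Ω → ℝ≥0∞ := fun R n ω =>
    ε n + (ε n)⁻¹ ^ k * (K n * (K (n + 1) * S R n ω))
  have hloc := ae_locallyIntegrable_of_moment (μ := μ) hX hM
  have hSm : ∀ R n, Measurable (S R n) := fun R n =>
    (lintegral_oscillation_le hX hM R (mul_pos two_pos (hr n))).1
  have hbm : ∀ R n, Measurable (b R n) := fun R n => by
    have := hSm R n
    fun_prop
  have hb : ∀ R, ∃ B : ℝ≥0∞, B ≠ ∞ ∧ ∀ n, ∫⁻ ω, b R n ω ∂P ≤ B * ε n := by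
    intro R
    let D : ℝ≥0∞ := μ (ball 0 (R : ℝ)) * (μ (ball 0 1) * M * 2 ^ (d + (d + j + 1)))
    have hD : D ≠ ∞ := by
      refine ENNReal.mul_ne_top measure_ball_lt_top.ne (ENNReal.mul_ne_top
        (ENNReal.mul_ne_top measure_ball_lt_top.ne ENNReal.coe_ne_top) (by simp))
    refine ⟨1 + C * (C * 2 ^ ((k + 1) * d)) * D, ?_, fun n => ?_⟩
    · refine ENNReal.add_ne_top.2 ⟨by simp, ENNReal.mul_ne_top (ENNReal.mul_ne_top hC
        (ENNReal.mul_ne_top hC (by simp))) hD⟩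
    have hS : ∫⁻ ω, S R n ω ∂P ≤ D * (ε n ^ (k + 1)) ^ (2 * d + 1) := by
      refine (lintegral_oscillation_le hX hM R (mul_pos two_pos (hr n))).2.trans ?_
      rw [ENNReal.ofReal_mul two_pos.le, hrε, ENNReal.ofReal_ofNat, mul_pow]
      calc _ = D * (ε n ^ (k + 1)) ^ (2 * d + 1 + j) := by simp only [D]; ring
        _ ≤ _ := by
          gcongr D * ?_
          exact pow_le_pow_right_of_le_one' (pow_le_one' (hε1 n) _) (by omega)
    have hei : (ε n)⁻¹ * ε n = 1 := ENNReal.inv_mul_cancel (hε0 n) (hεt n)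
    have hes : (ε (n + 1))⁻¹ = 2 * (ε n)⁻¹ := by
      simp only [ε, ← ENNReal.inv_pow, inv_inv, pow_succ']
    calc ∫⁻ ω, b R n ω ∂P
        = ε n + (ε n)⁻¹ ^ k * (K n * (K (n + 1) * ∫⁻ ω, S R n ω ∂P)) := by
          have := hSm R n
          simp only [b]
          rw [lintegral_add_left measurable_const, lintegral_const_mul _ (by fun_prop),
            lintegral_const_mul _ (by fun_prop), lintegral_const_mul _ (by fun_prop)]
          simp
      _ ≤ ε n + (ε n)⁻¹ ^ k * (K n * (K (n + 1) * (D * (ε n ^ (k + 1)) ^ (2 * d + 1)))) := by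
          gcongr
      _ = ε n + C * (C * 2 ^ ((k + 1) * d)) * D
            * ((ε n)⁻¹ * ε n) ^ (k + (k + 1) * d + (k + 1) * d) * ε n := by
          simp only [K, hrε, ENNReal.inv_pow, hes]
          ring
      _ = _ := by rw [hei]; ring
  have hbsum : ∀ᵐ ω ∂P, ∀ R, ∑' n, b R n ω < ∞ := by
    refine ae_all_iff.2 fun R => ?_
    obtain ⟨B, hB, hBn⟩ := hb R
    refine ae_lt_top (Measurable.tsum (hbm R)) ?_
    rw [lintegral_tsum fun n => (hbm R n).aemeasurable]
    refine ((ENNReal.tsum_le_tsum hBn).trans_lt ?_).ne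
    rw [ENNReal.tsum_mul_left]
    exact (ENNReal.mul_ne_top hB hεsum).lt_top
  have hdiff : ∀ ω, LocallyIntegrable (X ω) μ → ∀ R : ℕ, ∀ n, ∀ x ∈ ball (0 : E) R,
      ‖A (n + 1) ω x - A n ω x‖ₑ ≤ b (R + 1) n ω := by
    intro ω hω R n x hx
    rw [enorm_sub_rev]
    refine (hκ n).enorm_integral_sub_integral_le (hκ (n + 1)) (hK n) (hK (n + 1)) ?_ (hXω ω) hω
      ?_ (hε0 n) k
    · exact pow_le_pow_left₀ (by positivity) (pow_le_pow_of_le_one (by norm_num) (by norm_num)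
        n.le_succ) _
    · rw [mem_ball_zero_iff] at hx
      push_cast
      linarith [hr1 n]
  have hbound : ∀ ω, LocallyIntegrable (X ω) μ → (∀ R, ∑' n, b R n ω < ∞) → ∀ R : ℕ,
      Summable (fun n => (b (R + 1) n ω).toReal) ∧ ∀ n, ∀ x ∈ ball (0 : E) R,
        ‖A (n + 1) ω x - A n ω x‖ ≤ (b (R + 1) n ω).toReal := by
    intro ω hω hs R
    refine ⟨ENNReal.summable_toReal (hs _).ne, fun n x hx => ?_⟩
    rw [← toReal_enorm]
    exact ENNReal.toReal_mono (ENNReal.ne_top_of_tsum_ne_top (hs _).ne n) (hdiff ω hω R n x hx)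
  refine ⟨fun ω x => A 0 ω x + ∑' n, (A (n + 1) ω x - A n ω x), fun x => ?_, ?_⟩
  · have hmom : ∀ n, ∫⁻ ω, ∫⁻ u, ‖κ n (x - u)‖ₑ * ‖X ω u - X ω x‖ₑ ∂μ ∂P ≤ (1 + M) * ε n := by
      intro n
      have hκm : Measurable (κ n) := (hκ n).continuous.measurable
      have hmeas : Measurable fun p : Ω × E => ‖κ n (x - p.2)‖ₑ * ‖X p.1 p.2 - X p.1 x‖ₑ :=
        Measurable.mul (by fun_prop) (hX.sub ((hXu x).comp measurable_fst)).enorm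
      rw [lintegral_lintegral_swap hmeas.aemeasurable]
      calc ∫⁻ u, ∫⁻ ω, ‖κ n (x - u)‖ₑ * ‖X ω u - X ω x‖ₑ ∂P ∂μ
          ≤ ∫⁻ u, ‖κ n (x - u)‖ₑ * ((1 + M) * ε n) ∂μ := by
            refine lintegral_mono fun u => ?_
            rw [lintegral_const_mul' _ _ enorm_ne_top]
            by_cases hu : r n ≤ ‖x - u‖
            · simp [(hκ n).eq_zero _ hu]
            gcongr
            calc ∫⁻ ω, ‖X ω u - X ω x‖ₑ ∂P
                ≤ ∫⁻ ω, (ε n + (ε n)⁻¹ ^ k * ‖X ω u - X ω x‖ₑ ^ (k + 1)) ∂P :=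
                  lintegral_mono fun ω => le_add_inv_pow_mul_pow _ (hε0 n) k
              _ = ε n + (ε n)⁻¹ ^ k * ∫⁻ ω, ‖X ω u - X ω x‖ₑ ^ (k + 1) ∂P := by
                  have := hXu u
                  have := hXu x
                  rw [lintegral_add_left measurable_const,
                    lintegral_const_mul _ (by fun_prop)]
                  simp
              _ ≤ ε n + (ε n)⁻¹ ^ k * (M * (ε n ^ (k + 1)) ^ 1) := by
                  gcongr
                  refine (hM u x).trans ?_
                  gcongr M * ?_
                  calc ‖u - x‖ₑ ^ (d + j + 1) ≤ (ε n ^ (k + 1)) ^ (d + j + 1) := by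
                        gcongr
                        rw [← hrε, ← ofReal_norm, norm_sub_rev]
                        exact ENNReal.ofReal_le_ofReal (not_le.1 hu).le
                    _ ≤ _ := pow_le_pow_right_of_le_one' (pow_le_one' (hε1 n) _) (by omega)
              _ = ε n + ((ε n)⁻¹ * ε n) ^ k * (M * ε n) := by ring
              _ = _ := by
                  rw [ENNReal.inv_mul_cancel (hε0 n) (hεt n)]; ring
        _ = _ := by
            rw [lintegral_mul_const _ (by fun_prop), (hκ n).lintegral_enorm_eq_one, one_mul]
    have hsum : ∀ᵐ ω ∂P, ∑' n, ∫⁻ u, ‖κ n (x - u)‖ₑ * ‖X ω u - X ω x‖ₑ ∂μ < ∞ := by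
      have hmeas : ∀ n, Measurable fun ω => ∫⁻ u, ‖κ n (x - u)‖ₑ * ‖X ω u - X ω x‖ₑ ∂μ := by
        intro n
        have hκm : Measurable (κ n) := (hκ n).continuous.measurable
        have hmeas : Measurable fun p : Ω × E => ‖κ n (x - p.2)‖ₑ * ‖X p.1 p.2 - X p.1 x‖ₑ :=
          Measurable.mul (by fun_prop) (hX.sub ((hXu x).comp measurable_fst)).enorm
        exact hmeas.lintegral_prod_right'
      refine ae_lt_top (Measurable.tsum hmeas) ?_
      rw [lintegral_tsum fun n => (hmeas n).aemeasurable]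
      refine ((ENNReal.tsum_le_tsum hmom).trans_lt ?_).ne
      rw [ENNReal.tsum_mul_left]
      exact (ENNReal.mul_ne_top (by simp) hεsum).lt_top
    filter_upwards [hloc, hbsum, hsum] with ω hω hbω hsω
    obtain ⟨R, hR⟩ := exists_nat_gt ‖x‖
    obtain ⟨h1, h2⟩ := hbound ω hω hbω R
    have h3 : Summable fun n => A (n + 1) ω x - A n ω x :=
      Summable.of_norm_bounded h1 fun n => h2 n x (by simpa using hR)
    have h4 := h3.hasSum.tendsto_sum_nat
    simp_rw [Finset.sum_range_sub (fun n => A n ω x)] at h4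
    have h5 : Tendsto (fun n => A n ω x) atTop (𝓝 (X ω x)) := by
      rw [tendsto_iff_edist_tendsto_0]
      refine tendsto_of_tendsto_of_tendsto_of_le_of_le tendsto_const_nhds
        (ENNReal.tendsto_atTop_zero_of_tsum_ne_top hsω.ne) (fun _ => zero_le) fun n => ?_
      rw [edist_eq_enorm_sub]
      exact (hκ n).enorm_integral_sub_le hω x _
    have h6 := tendsto_nhds_unique h4 (h5.sub_const _)
    rw [h6]
    ring
  · filter_upwards [hloc, hbsum] with ω hω hbω
    rw [continuous_iff_continuousAt]
    intro x
    obtain ⟨R, hR⟩ := exists_nat_gt ‖x‖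
    obtain ⟨h1, h2⟩ := hbound ω hω hbω R
    have hc : ∀ n, Continuous (A n ω) := fun n => (hκ n).continuous_integral hω
    refine (hc 0).continuousAt.add (ContinuousOn.continuousAt
      (continuousOn_tsum (fun n => ((hc (n + 1)).sub (hc n)).continuousOn) h1 h2)
      (isOpen_ball.mem_nhds (by simpa using hR)))

end Kolmogorov

section GaussianMoment

/-- The even moments of a centered Gaussian variable are controlled by its second moment. -/
theorem exists_lintegral_pow_le_of_map_eq_gaussianReal (n : ℕ) :
    ∃ C : ℝ≥0, ∀ {Ω : Type*} [MeasurableSpace Ω] (P : Measure Ω) (Y : Ω → ℝ) (v : ℝ≥0),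
      Measurable Y → P.map Y = gaussianReal 0 v →
        ∫⁻ ω, ‖Y ω‖ₑ ^ (2 * n) ∂P ≤ C * ENNReal.ofReal (∫ ω, Y ω ^ 2 ∂P) ^ n := by
  have hfin : ∫⁻ z, ‖z‖ₑ ^ (2 * n) ∂gaussianReal 0 1 ≠ ∞ := by
    have h := (memLp_id_gaussianReal (μ := 0) (v := 1) ((2 * n : ℕ) : ℝ≥0)).integrable_norm_pow'
    simpa [HasFiniteIntegral, enorm_pow] using h.hasFiniteIntegral.ne
  refine ⟨(∫⁻ z, ‖z‖ₑ ^ (2 * n) ∂gaussianReal 0 1).toNNReal, fun {Ω} _ P Y v hY hlaw => ?_⟩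
  rw [ENNReal.coe_toNNReal hfin]
  have hvar : ∫ ω, Y ω ^ 2 ∂P = v := by
    have h1 : ∫ ω, Y ω ^ 2 ∂P = ∫ z, z ^ 2 ∂P.map Y :=
      (integral_map hY.aemeasurable (by fun_prop : AEStronglyMeasurable (fun z : ℝ => z ^ 2) _)).symm
    have h2 := variance_fun_id_gaussianReal (μ := 0) (v := v)
    rw [variance_of_integral_eq_zero aemeasurable_id' integral_id_gaussianReal] at h2
    rw [h1, hlaw]
    exact h2
  have hscale : gaussianReal 0 v = (gaussianReal 0 1).map (fun z => Real.sqrt v * z) := by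
    rw [gaussianReal_map_const_mul]
    congr 1
    · simp
    · ext
      simp
  have h3 : ∫⁻ ω, ‖Y ω‖ₑ ^ (2 * n) ∂P = ∫⁻ z, ‖z‖ₑ ^ (2 * n) ∂P.map Y :=
    (lintegral_map (by fun_prop : Measurable fun z : ℝ => ‖z‖ₑ ^ (2 * n)) hY).symm
  have h4 : ‖Real.sqrt v‖ₑ ^ (2 * n) = ENNReal.ofReal (v : ℝ) ^ n := by
    rw [pow_mul, ← enorm_pow, Real.sq_sqrt v.coe_nonneg, Real.enorm_of_nonneg v.coe_nonneg]
  rw [h3, hvar, hlaw, hscale, lintegral_map (by fun_prop) (by fun_prop)]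
  simp_rw [enorm_mul, mul_pow]
  rw [lintegral_const_mul _ (by fun_prop), h4, mul_comm]

end GaussianMoment

section Covariance

variable {q : Plane → ℝ}

theorem CondWeak.exists_envelope (hq : CondWeak q) :
    ∃ G : Plane → ℝ, MemLp G 2 ∧ ∀ a w, ‖w - a‖ ≤ 1 →
      |q w| ≤ G a ∧ |q w - q a| ≤ G a * ‖w - a‖ := by
  obtain ⟨hC, c, hc, δ, hδ, hbd⟩ := hq
  have hmax : ∀ a w : Plane, ‖w - a‖ ≤ 1 →
      c * max 1 ‖w‖ ^ (-(1 + δ)) ≤ c * (3⁻¹ * (1 + ‖a‖)) ^ (-(1 + δ)) := by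
    intro a w hw
    gcongr c * ?_
    refine Real.rpow_le_rpow_of_nonpos (by positivity) ?_ (by linarith)
    have h1 : ‖a‖ - 1 ≤ ‖w‖ := by linarith [norm_le_norm_add_norm_sub w a]
    rcases le_total ‖a‖ 2 with h | h
    · exact le_max_of_le_left (by linarith)
    · exact le_max_of_le_right (by linarith)
  refine ⟨fun a => c * (3⁻¹ * (1 + ‖a‖)) ^ (-(1 + δ)), ?_, fun a w hw => ⟨?_, ?_⟩⟩
  · rw [memLp_two_iff_integrable_sq (Measurable.aestronglyMeasurable (by fun_prop))]
    have h := (integrable_one_add_norm (E := Plane) (μ := volume) (r := 2 * (1 + δ))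
      (by simp; linarith)).const_mul ((c * 3⁻¹ ^ (-(1 + δ))) ^ 2)
    refine h.congr (ae_of_all _ fun a => ?_)
    have ha : 0 ≤ 1 + ‖a‖ := by positivity
    simp only
    rw [Real.mul_rpow (by norm_num) ha, ← mul_assoc, mul_pow _ ((1 + ‖a‖) ^ _),
      ← Real.rpow_mul_natCast ha]
    congr 2
    push_cast
    ring
  · have h := hbd 0 (by norm_num) w
    rw [norm_iteratedFDeriv_zero, Real.norm_eq_abs] at h
    exact h.trans (hmax a w hw)
  · rw [← Real.norm_eq_abs]
    refine (convex_closedBall a 1).norm_image_sub_le_of_norm_fderiv_le (𝕜 := ℝ)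
      (fun z _ => (hC.differentiable (by norm_num)).differentiableAt) (fun z hz => ?_)
      (mem_closedBall_self zero_le_one) (by rwa [mem_closedBall, dist_eq_norm])
    have h := hbd 1 (by norm_num) z
    rw [norm_iteratedFDeriv_one] at h
    exact h.trans (hmax a z (by rwa [mem_closedBall, dist_eq_norm] at hz))

theorem CondWeak.memLp_two (hq : CondWeak q) : MemLp q 2 := by
  obtain ⟨G, hG, hqG⟩ := hq.exists_envelope
  refine hG.mono hq.1.continuous.aestronglyMeasurable (ae_of_all _ fun a => ?_)
  exact (hqG a a (by simp)).1.trans (le_abs_self _)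

theorem MeasureTheory.MemLp.comp_const_sub {p : Plane → ℝ} (hp : MemLp p 2) (x : Plane) :
    MemLp (fun z => p (x - z)) 2 :=
  hp.comp_measurePreserving (Measure.measurePreserving_sub_left volume x)

/-- The spatial covariance is Lipschitz at the diagonal. -/
theorem CondWeak.exists_covariance_bound (hq : CondWeak q) :
    ∃ B : ℝ, 0 ≤ B ∧ ∀ x y : Plane,
      (∫ z : Plane, q (x - z) * q (y - z)) ≤ ∫ z : Plane, q z * q z ∧
      2 * (∫ z : Plane, q z * q z) - 2 * (∫ z : Plane, q (x - z) * q (y - z)) ≤ B * ‖x - y‖ := by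
  obtain ⟨G, hG, hqG⟩ := hq.exists_envelope
  set c₀ := ∫ z : Plane, q z * q z
  have hc₀ : 0 ≤ c₀ := integral_nonneg fun z => mul_self_nonneg _
  have hL := fun x => hq.memLp_two.comp_const_sub x
  have hdiag : ∀ x, ∫ z, q (x - z) * q (x - z) = c₀ := fun x =>
    integral_sub_left_eq_self (fun z => q z * q z) volume x
  have hintegr : ∀ x y, Integrable fun z => q (x - z) * q (y - z) := fun x y =>
    (hL x).integrable_mul (hL y)
  have hsub : ∀ x y, ∫ z, (q (x - z) - q (y - z)) ^ 2
      = 2 * c₀ - 2 * ∫ z, q (x - z) * q (y - z) := by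
    intro x y
    have : ∀ z, (q (x - z) - q (y - z)) ^ 2 = q (x - z) * q (x - z)
        - 2 * (q (x - z) * q (y - z)) + q (y - z) * q (y - z) := fun z => by ring
    have hi : Integrable fun z => q (x - z) * q (x - z) - 2 * (q (x - z) * q (y - z)) :=
      (hintegr x x).sub ((hintegr x y).const_mul 2)
    simp_rw [this]
    rw [integral_add hi (hintegr y y),
      integral_sub (hintegr x x) ((hintegr x y).const_mul 2), integral_const_mul, hdiag, hdiag]
    ring
  have hadd : ∀ x y, ∫ z, (q (x - z) + q (y - z)) ^ 2
      = 2 * c₀ + 2 * ∫ z, q (x - z) * q (y - z) := by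
    intro x y
    have : ∀ z, (q (x - z) + q (y - z)) ^ 2 = q (x - z) * q (x - z)
        + 2 * (q (x - z) * q (y - z)) + q (y - z) * q (y - z) := fun z => by ring
    have hi : Integrable fun z => q (x - z) * q (x - z) + 2 * (q (x - z) * q (y - z)) :=
      (hintegr x x).add ((hintegr x y).const_mul 2)
    simp_rw [this]
    rw [integral_add hi (hintegr y y),
      integral_add (hintegr x x) ((hintegr x y).const_mul 2), integral_const_mul, hdiag, hdiag]
    ring
  have hK : 0 ≤ ∫ z, G z ^ 2 := integral_nonneg fun z => sq_nonneg _
  refine ⟨(∫ z, G z ^ 2) + 4 * c₀, by positivity, fun x y => ⟨?_, ?_⟩⟩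
  · have : 0 ≤ ∫ z, (q (x - z) - q (y - z)) ^ 2 := integral_nonneg fun z => sq_nonneg _
    linarith [hsub x y]
  · rcases le_total ‖x - y‖ 1 with h | h
    · rw [← hsub x y]
      calc ∫ z, (q (x - z) - q (y - z)) ^ 2 ≤ ∫ z, G (y - z) ^ 2 * ‖x - y‖ ^ 2 := by
            refine integral_mono ((hL x).sub (hL y)).integrable_sq
              ((hG.comp_const_sub y).integrable_sq.mul_const _) fun z => ?_
            have h1 := (hqG (y - z) (x - z) (by simpa using h)).2
            rw [sub_sub_sub_cancel_right] at h1
            simp only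
            rw [← mul_pow, ← sq_abs]
            exact pow_le_pow_left₀ (abs_nonneg _) h1 2
        _ = (∫ z, G z ^ 2) * ‖x - y‖ ^ 2 := by
            rw [integral_mul_const, integral_sub_left_eq_self (fun z => G z ^ 2) volume y]
        _ ≤ _ := by
            have : ‖x - y‖ ^ 2 ≤ ‖x - y‖ := by nlinarith [norm_nonneg (x - y)]
            nlinarith [norm_nonneg (x - y)]
    · have h1 : 0 ≤ ∫ z, (q (x - z) + q (y - z)) ^ 2 := integral_nonneg fun z => sq_nonneg _
      rw [hadd] at h1
      nlinarith

end Covariance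

/-- **Existence of a continuous modification.** If `q` satisfies Condition (Weak) and `f` is
a jointly measurable centered Gaussian family with covariance
`E[f(t,x) f(s,y)] = e^{-|t-s|} ∫ q(x-z) q(y-z) dz`, then `f` admits a modification `f̃` that
is almost surely continuous in `(t,x) ∈ ℝ≥0 × ℝ²`. -/
theorem exists_continuous_modification
    (q : Plane → ℝ) (hq : CondWeak q)
    {Ω : Type*} [MeasurableSpace Ω] (P : Measure Ω) [IsProbabilityMeasure P]
    (f : Ω → ℝ → Plane → ℝ)
    (hmeas : Measurable fun p : Ω × (ℝ × Plane) => f p.1 p.2.1 p.2.2)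
    (hgauss : ∀ (n : ℕ) (c : Fin n → ℝ) (ts : Fin n → ℝ) (xs : Fin n → Plane),
      (∀ i, 0 ≤ ts i) → ∃ v : ℝ≥0,
        P.map (fun ω => ∑ i, c i * f ω (ts i) (xs i)) = ProbabilityTheory.gaussianReal 0 v)
    (hcov : ∀ (s t : ℝ), 0 ≤ s → 0 ≤ t → ∀ x y : Plane,
      ∫ ω, f ω t x * f ω s y ∂P
        = Real.exp (-|t - s|) * ∫ z : Plane, q (x - z) * q (y - z)) :
    ∃ g : Ω → ℝ → Plane → ℝ,
      (∀ t : ℝ, 0 ≤ t → ∀ x : Plane, ∀ᵐ ω ∂P, g ω t x = f ω t x) ∧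
      (∀ᵐ ω ∂P,
        ContinuousOn (fun p : ℝ × Plane => g ω p.1 p.2) (Set.Ici 0 ×ˢ Set.univ)) := by
  have hf : ∀ t x, Measurable fun ω => f ω t x := fun t x =>
    hmeas.comp (measurable_prodMk_right (y := (t, x)))
  have hX : Measurable (Function.uncurry fun ω (p : ℝ × Plane) => f ω |p.1| p.2) :=
    hmeas.comp (f := fun p : Ω × (ℝ × Plane) => (p.1, (|p.2.1|, p.2.2))) (by fun_prop)
  obtain ⟨C, hC⟩ := exists_lintegral_pow_le_of_map_eq_gaussianReal 4
  obtain ⟨B, hB0, hB⟩ := hq.exists_covariance_bound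
  set c₀ := ∫ z : Plane, q z * q z
  have hc₀ : 0 ≤ c₀ := integral_nonneg fun z => mul_self_nonneg _
  have hdiag : ∀ x : Plane, ∫ z, q (x - z) * q (x - z) = c₀ := fun x =>
    integral_sub_left_eq_self (fun z => q z * q z) volume x
  have hL2 : ∀ t x, 0 ≤ t → MemLp (fun ω => f ω t x) 2 P := by
    intro t x ht
    obtain ⟨v, hv⟩ := hgauss 1 (fun _ => 1) (fun _ => t) (fun _ => x) (fun _ => ht)
    simp only [Finset.univ_unique, one_mul, Finset.sum_const, Finset.card_singleton,
      one_smul] at hv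
    have h := memLp_id_gaussianReal (μ := 0) (v := v) 2
    rw [← hv] at h
    exact h.comp_of_map (hf t x).aemeasurable
  have hvar : ∀ t s x y, 0 ≤ t → 0 ≤ s →
      ∫ ω, (f ω t x - f ω s y) ^ 2 ∂P ≤ B * ‖x - y‖ + 2 * c₀ * |t - s| := by
    intro t s x y ht hs
    have hintegr : ∀ t s x y, 0 ≤ t → 0 ≤ s → Integrable (fun ω => f ω t x * f ω s y) P :=
      fun t s x y ht hs => (hL2 t x ht).integrable_mul (hL2 s y hs)
    have hsq : ∀ ω, (f ω t x - f ω s y) ^ 2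
        = f ω t x * f ω t x - 2 * (f ω t x * f ω s y) + f ω s y * f ω s y := fun ω => by ring
    have hi : Integrable (fun ω => f ω t x * f ω t x - 2 * (f ω t x * f ω s y)) P :=
      (hintegr t t x x ht ht).sub ((hintegr t s x y ht hs).const_mul 2)
    simp_rw [hsq]
    rw [integral_add hi (hintegr s s y y hs hs), integral_sub (hintegr t t x x ht ht)
      ((hintegr t s x y ht hs).const_mul 2), integral_const_mul, hcov t t ht ht, hcov s s hs hs,
      hcov s t hs ht, hdiag, hdiag]
    obtain ⟨h1, h2⟩ := hB x y
    set I := ∫ z : Plane, q (x - z) * q (y - z)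
    have h3 : 1 - |t - s| ≤ Real.exp (-|t - s|) := by
      linarith [Real.add_one_le_exp (-|t - s|)]
    have h4 : Real.exp (-|t - s|) ≤ 1 := Real.exp_le_one_iff.2 (by simp)
    have h5 : (1 - Real.exp (-|t - s|)) * I ≤ |t - s| * c₀ :=
      (mul_le_mul_of_nonneg_left h1 (by linarith)).trans
        (mul_le_mul_of_nonneg_right (by linarith) hc₀)
    simp only [sub_self, abs_zero, neg_zero, Real.exp_zero, one_mul]
    linarith
  have hmom : ∀ u v : ℝ × Plane, ∫⁻ ω, ‖f ω |u.1| u.2 - f ω |v.1| v.2‖ₑ ^ (7 + 1) ∂P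
      ≤ (C * (B + 2 * c₀).toNNReal ^ 4 : ℝ≥0) * ‖u - v‖ₑ ^ 4 := by
    rintro ⟨t, x⟩ ⟨s, y⟩
    obtain ⟨w, hw⟩ := hgauss 2 ![1, -1] ![|t|, |s|] ![x, y] (by
      intro i; fin_cases i <;> simp)
    simp only [Fin.sum_univ_two, Matrix.cons_val_zero, Matrix.cons_val_one, one_mul,
      neg_mul, ← sub_eq_add_neg] at hw
    refine (hC P _ w ((hf _ _).sub (hf _ _)) hw).trans ?_
    have h1 : ∫ ω, (f ω |t| x - f ω |s| y) ^ 2 ∂P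
        ≤ (B + 2 * c₀) * ‖((t, x) - (s, y) : ℝ × Plane)‖ := by
      refine (hvar _ _ x y (abs_nonneg t) (abs_nonneg s)).trans ?_
      have h2 : ‖x - y‖ ≤ ‖((t, x) - (s, y) : ℝ × Plane)‖ := norm_snd_le ((t, x) - (s, y))
      have h3 : |t - s| ≤ ‖((t, x) - (s, y) : ℝ × Plane)‖ := norm_fst_le ((t, x) - (s, y))
      have h4 := (abs_abs_sub_abs_le t s).trans h3
      rw [add_mul]
      gcongr
    rw [ENNReal.coe_mul, ENNReal.coe_pow, mul_assoc, ← mul_pow]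
    gcongr
    refine (ENNReal.ofReal_le_ofReal h1).trans_eq ?_
    rw [ENNReal.ofReal_mul (by positivity), ofReal_norm]
    rfl
  obtain ⟨g, hg, hgc⟩ := exists_continuous_modification_of_moment hX
    (by simp : Module.finrank ℝ (ℝ × Plane) < 4) hmom
  refine ⟨fun ω t x => g ω (t, x), fun t ht x => ?_, ?_⟩
  · filter_upwards [hg (t, x)] with ω hω
    simpa [abs_of_nonneg ht] using hω
  · filter_upwards [hgc] with ω hω
    exact hω.continuousOn

end
end

section
/- Let q : ℝ² → ℝ be C² and suppose there exist c, δ > 0 such that |∂^α q(x)| ≤ c(1 ∨ |x|)^{−(1+δ)} for every multi-index α with |α| ≤ 2 and every x ∈ ℝ². Then there exists a constant C depending only on c and δ such that for every w ∈ ℝ²: | ∫_{ℝ²} q(z) ( q(z) − q(z+w) ) dz | ≤ C |w|². -/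
open MeasureTheory Set
open scoped ENNReal NNReal

noncomputable section

/-- The autocorrelation increment of a square-integrable function is half of the squared `L²` norm
of the increment. -/
theorem integral_mul_sub_translate_eq {E : Type*} [MeasurableSpace E] [AddGroup E]
    [MeasurableAdd E] {μ : Measure E} [μ.IsAddRightInvariant] {q : E → ℝ} (hq : MemLp q 2 μ)
    (w : E) :
    ∫ z, q z * (q z - q (z + w)) ∂μ = (∫ z, (q z - q (z + w)) ^ 2 ∂μ) / 2 := by
  have hqw : MemLp (fun z => q (z + w)) 2 μ :=
    hq.comp_measurePreserving (measurePreserving_add_right μ w)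
  have h1 : Integrable (fun z => q z * (q z - q (z + w))) μ := hq.integrable_mul (hq.sub hqw)
  have h2 : Integrable (fun z => q (z + w) ^ 2) μ := hqw.integrable_sq
  have h3 : Integrable (fun z => q z ^ 2) μ := hq.integrable_sq
  have h4 : ∫ z, q (z + w) ^ 2 ∂μ = ∫ z, q z ^ 2 ∂μ :=
    integral_add_right_eq_self (fun z => q z ^ 2) w
  have h5 : ∫ z, (q z - q (z + w)) ^ 2 ∂μ
      = ∫ z, (2 * (q z * (q z - q (z + w))) + (q (z + w) ^ 2 - q z ^ 2)) ∂μ := by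
    congr 1 with z
    ring
  rw [h5, integral_add (h1.const_mul 2) (by exact h2.sub h3), integral_sub h2 h3, h4,
    integral_const_mul]
  ring

/-- Within unit distance of `z`, the weight `max 1 ‖y‖ ^ (-s)` is controlled by
`(1 + ‖z‖) ^ (-s)`. -/
theorem max_one_norm_rpow_neg_le {E : Type*} [SeminormedAddCommGroup E] {s : ℝ} (hs : 0 ≤ s)
    {y z : E} (hyz : ‖y - z‖ ≤ 1) :
    max 1 ‖y‖ ^ (-s) ≤ 4 ^ s * (1 + ‖z‖) ^ (-s) := by
  have hz : ‖z‖ ≤ ‖y‖ + ‖y - z‖ := by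
    simpa [norm_sub_rev] using norm_le_insert y z
  have h1 := le_max_left 1 ‖y‖
  have h2 := le_max_right 1 ‖y‖
  have hz0 := norm_nonneg z
  calc max 1 ‖y‖ ^ (-s) ≤ ((1 + ‖z‖) / 4) ^ (-s) :=
        Real.rpow_le_rpow_of_nonpos (by positivity) (by linarith) (by linarith)
    _ = 4 ^ s * (1 + ‖z‖) ^ (-s) := by
        rw [Real.div_rpow (by positivity) (by norm_num), Real.rpow_neg (by norm_num : (0:ℝ) ≤ 4)]
        field_simp

/-- **Taylor estimate for the self-correlation of `q`.** If `q : ℝ² → ℝ` is `C²` with all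
derivatives up to order 2 bounded by `c (1 ∨ |x|)^{-(1+δ)}`, then there is a constant
`C = C(c,δ)` such that `|∫ q(z)(q(z) - q(z+w)) dz| ≤ C |w|²` for every `w ∈ ℝ²`. -/
theorem self_correlation_increment_bound
    (c δ : ℝ) (hc : 0 < c) (hδ : 0 < δ) :
    ∃ C > (0 : ℝ), ∀ q : Plane → ℝ,
      ContDiff ℝ 2 q →
      (∀ k : ℕ, k ≤ 2 → ∀ x : Plane,
        ‖iteratedFDeriv ℝ k q x‖ ≤ c * max 1 ‖x‖ ^ (-(1 + δ))) →
      ∀ w : Plane,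
        |∫ z : Plane, q z * (q z - q (z + w))| ≤ C * ‖w‖ ^ 2 := by
  set G : Plane → ℝ := fun z => c * (4 ^ (1 + δ) * (1 + ‖z‖) ^ (-(1 + δ))) with hG
  have hG0 : ∀ z, 0 ≤ G z := fun z => by positivity
  have hGc : Continuous G := by
    have : Continuous fun z : Plane => (1 + ‖z‖) ^ (-(1 + δ)) :=
      (continuous_const.add continuous_norm).rpow_const fun z =>
        Or.inl (by positivity : (0 : ℝ) < 1 + ‖z‖).ne'
    fun_prop
  have hG2 : Integrable (fun z => G z ^ 2) := by
    have h := (integrable_one_add_norm (E := Plane) (μ := volume) (r := 2 * (1 + δ))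
      (by simp; linarith)).const_mul ((c * 4 ^ (1 + δ)) ^ 2)
    refine h.congr (Filter.Eventually.of_forall fun z => ?_)
    have : (1 + ‖z‖) ^ (-(2 * (1 + δ))) = ((1 + ‖z‖) ^ (-(1 + δ))) ^ 2 := by
      rw [← Real.rpow_mul_natCast (by positivity)]
      congr 1
      push_cast
      ring
    simp only [hG, this]
    ring
  have hGLp : MemLp G 2 := (memLp_two_iff_integrable_sq hGc.aestronglyMeasurable).2 hG2
  have hI : 0 ≤ ∫ z, G z ^ 2 := integral_nonneg fun z => sq_nonneg _
  refine ⟨2 * (∫ z, G z ^ 2) + 1, by positivity, fun q hq hbound w => ?_⟩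
  have hnear : ∀ {k : ℕ}, k ≤ 2 → ∀ {y z : Plane}, ‖y - z‖ ≤ 1 →
      ‖iteratedFDeriv ℝ k q y‖ ≤ G z := fun hk y z hyz =>
    (hbound _ hk y).trans
      (mul_le_mul_of_nonneg_left (max_one_norm_rpow_neg_le (by linarith) hyz) hc.le)
  have hqG : ∀ z, |q z| ≤ G z := fun z => by
    simpa using hnear (k := 0) (by norm_num) (y := z) (z := z) (by simp)
  have hqLp : MemLp q 2 := hGLp.mono hq.continuous.aestronglyMeasurable
    (Filter.Eventually.of_forall fun z => (hqG z).trans (le_abs_self _))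
  have hGw : Integrable fun z => G (z + w) ^ 2 := hG2.comp_add_right w
  rw [integral_mul_sub_translate_eq hqLp, abs_of_nonneg (by positivity)]
  rcases le_total ‖w‖ 1 with hw | hw
  · have hinc : ∀ z, |q z - q (z + w)| ≤ G z * ‖w‖ := fun z => by
      have h := (convex_closedBall z 1).norm_image_sub_le_of_norm_fderiv_le (𝕜 := ℝ) (f := q)
        (C := G z) (x := z + w) (y := z)
        (fun y _ => hq.differentiable (by norm_num) y)
        (fun y hy => by
          rw [← norm_iteratedFDeriv_one]
          exact hnear (by norm_num) (mem_closedBall_iff_norm.1 hy))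
        (by simpa [mem_closedBall_iff_norm] using hw) (by simp)
      simpa using h
    have h : ∫ z, (q z - q (z + w)) ^ 2 ≤ ∫ z, G z ^ 2 * ‖w‖ ^ 2 := by
      refine integral_mono_of_nonneg (Filter.Eventually.of_forall fun z => sq_nonneg _)
        (hG2.mul_const _) (Filter.Eventually.of_forall fun z => ?_)
      simpa only [mul_pow, sq_abs] using pow_le_pow_left₀ (abs_nonneg _) (hinc z) 2
    rw [integral_mul_const] at h
    nlinarith [mul_nonneg hI (sq_nonneg ‖w‖), sq_nonneg ‖w‖]
  · have h : ∫ z, (q z - q (z + w)) ^ 2 ≤ ∫ z, (2 * G z ^ 2 + 2 * G (z + w) ^ 2) := by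
      refine integral_mono_of_nonneg (Filter.Eventually.of_forall fun z => sq_nonneg _)
        ((hG2.const_mul 2).add (hGw.const_mul 2)) (Filter.Eventually.of_forall fun z => ?_)
      have h1 := sq_le_sq' (abs_le.1 (hqG z)).1 (abs_le.1 (hqG z)).2
      have h2 := sq_le_sq' (abs_le.1 (hqG (z + w))).1 (abs_le.1 (hqG (z + w))).2
      simp only
      nlinarith [sq_nonneg (q z + q (z + w))]
    rw [integral_add (hG2.const_mul 2) (hGw.const_mul 2), integral_const_mul, integral_const_mul,
      integral_add_right_eq_self (fun z => G z ^ 2) w] at h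
    have hw2 : 1 ≤ ‖w‖ ^ 2 := one_le_pow₀ hw
    nlinarith [mul_nonneg hI (sub_nonneg.2 hw2)]

end
end
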